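/- arXiv:2111.07844 — 7 statements merged into one kernel-verified Lean document; each statement's English description precedes it below -/
import Mathlib

section
/- Let λ > 0 and let u be the exponential utility u(x) = (1 − e^{−λx})/λ. Then for every random variable X with e^{−λX} ∈ L¹(P), the optimized certainty equivalent equals the entropic risk functional: sup_{y ∈ ℝ} ( E[u(y + X)] − y ) = −(1/λ) log E[e^{−λX}]. -/
open MeasureTheory Filter Real
open scoped ENNReal Topology

/-- The exponential utility of a shifted random variable integrates to an explicit function of
the shift and of the logarithm of `E[e^{-λX}]`. -/
lemma integral_exponential_utility_add
    {Ω : Type*} [MeasurableSpace Ω] (P : Measure Ω) [IsProbabilityMeasure P]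
    (lam : ℝ) (X : Ω → ℝ) (hint : Integrable (fun ω => Real.exp (-lam * X ω)) P) (y : ℝ) :
    ∫ ω, (1 - Real.exp (-lam * (y + X ω))) / lam ∂P
      = (1 - Real.exp (Real.log (∫ ω, Real.exp (-lam * X ω) ∂P) - lam * y)) / lam := by
  have hpos : 0 < ∫ ω, Real.exp (-lam * X ω) ∂P := integral_exp_pos hint
  have hsplit : ∀ ω, Real.exp (-lam * (y + X ω))
      = Real.exp (-(lam * y)) * Real.exp (-lam * X ω) := fun ω => by
    rw [← Real.exp_add]
    ring_nf
  simp_rw [hsplit]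
  rw [integral_div, integral_sub (integrable_const 1) (hint.const_mul _), integral_const_mul,
    sub_eq_add_neg (Real.log _), Real.exp_add, Real.exp_log hpos]
  simp [mul_comm]

/-- For the exponential utility `u(x) = (1 - e^{-λx})/λ` with `λ > 0`, the optimized
certainty equivalent of any random variable `X` with `e^{-λX} ∈ L¹(P)` equals the
entropic risk functional `-(1/λ) log E[e^{-λX}]`. -/
theorem oce_exponential_eq_entropic
    {Ω : Type*} [MeasurableSpace Ω] (P : Measure Ω) [IsProbabilityMeasure P]
    (lam : ℝ) (hlam : 0 < lam)
    (u : ℝ → ℝ) (hu : ∀ x, u x = (1 - Real.exp (-lam * x)) / lam)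
    (X : Ω → ℝ) (hX : Measurable X)
    (hint : Integrable (fun ω => Real.exp (-lam * X ω)) P) :
    (⨆ y : ℝ, ((∫ ω, u (y + X ω) ∂P) - y))
      = -(1 / lam) * Real.log (∫ ω, Real.exp (-lam * X ω) ∂P) := by
  simp_rw [hu, integral_exponential_utility_add P lam X hint]
  set L := Real.log (∫ ω, Real.exp (-lam * X ω) ∂P)
  refine IsGreatest.csSup_eq ⟨⟨L / lam, ?_⟩, ?_⟩
  · simp only [mul_div_cancel₀ L hlam.ne', sub_self, Real.exp_zero]
    field_simp
    simp
  · rintro _ ⟨y, rfl⟩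
    have hexp := Real.add_one_le_exp (L - lam * y)
    have hdiv : (1 - Real.exp (L - lam * y)) / lam ≤ (lam * y - L) / lam :=
      div_le_div_of_nonneg_right (by linarith) hlam.le
    have heq : (lam * y - L) / lam = y - 1 / lam * L := by
      field_simp
    dsimp only
    linarith
end

section
/- Let λ > 0, let u be the exponential utility u(x) = (1 − e^{−λx})/λ, and let X be a Gaussian random variable with mean μ and variance σ². Then the optimized certainty equivalent of X equals the mean–variance objective: sup_{y ∈ ℝ} ( E[u(y + X)] − y ) = μ − (λ/2) σ². -/
open MeasureTheory ProbabilityTheory Filter Real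
open scoped ENNReal NNReal Topology

/-- The optimized certainty equivalent of `X` for the exponential utility is the entropic
certainty equivalent `-cgf X P (-λ) / λ`, and the supremum is attained. -/
theorem isGreatest_oce_exponential {Ω : Type*} [MeasurableSpace Ω] {P : Measure Ω}
    [IsProbabilityMeasure P] {lam : ℝ} (hlam : 0 < lam) {X : Ω → ℝ}
    (hint : Integrable (fun ω ↦ Real.exp (-lam * X ω)) P) :
    IsGreatest
      (Set.range fun y : ℝ ↦ (∫ ω, (1 - Real.exp (-lam * (y + X ω))) / lam ∂P) - y)
      (-cgf X P (-lam) / lam) := by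
  have hval (y : ℝ) : (∫ ω, (1 - Real.exp (-lam * (y + X ω))) / lam ∂P) =
      (1 - Real.exp (-lam * y + cgf X P (-lam))) / lam := by
    simp_rw [mul_add, Real.exp_add, exp_cgf hint]
    rw [integral_div, integral_sub (integrable_const 1) (hint.const_mul _), integral_const_mul]
    simp [mgf]
  simp_rw [hval]
  constructor
  · refine ⟨cgf X P (-lam) / lam, ?_⟩
    have h : -lam * (cgf X P (-lam) / lam) + cgf X P (-lam) = 0 := by
      field_simp
      ring
    simp only [h]
    simp [neg_div]
  · rintro _ ⟨y, rfl⟩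
    have h := Real.add_one_le_exp (-lam * y + cgf X P (-lam))
    simp only [sub_le_iff_le_add]
    rw [div_add' _ _ _ hlam.ne']
    gcongr
    linarith

/-- For the exponential utility `u(x) = (1 - e^{-λx})/λ` with `λ > 0` and a Gaussian
random variable `X ~ N(μ, σ²)`, the optimized certainty equivalent of `X` equals the
mean–variance objective `μ - (λ/2)σ²`. -/
theorem oce_exponential_gaussian_eq_mean_variance
    {Ω : Type*} [MeasurableSpace Ω] (P : Measure Ω) [IsProbabilityMeasure P]
    (lam : ℝ) (hlam : 0 < lam)
    (u : ℝ → ℝ) (hu : ∀ x, u x = (1 - Real.exp (-lam * x)) / lam)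
    (μ σ : ℝ) (hσ : 0 < σ)
    (X : Ω → ℝ) (hX : Measurable X)
    (hgauss : P.map X = gaussianReal μ (Real.toNNReal (σ ^ 2))) :
    (⨆ y : ℝ, ((∫ ω, u (y + X ω) ∂P) - y)) = μ - lam / 2 * σ ^ 2 := by
  have hint : Integrable (fun ω ↦ Real.exp (-lam * X ω)) P := by
    have h := integrable_exp_mul_gaussianReal (μ := μ) (v := Real.toNNReal (σ ^ 2)) (-lam)
    rw [← hgauss] at h
    exact h.comp_measurable hX
  simp_rw [hu]
  rw [← sSup_range, (isGreatest_oce_exponential hlam hint).csSup_eq, cgf,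
    mgf_gaussianReal hgauss, Real.log_exp, Real.coe_toNNReal _ (sq_nonneg σ)]
  field_simp
  ring
end

section
/- Let f : ℝ → ℝ be concave and C¹, and let ξ, ξ* be random variables such that f(εξ + ξ*) ∈ L¹(P) for every ε ∈ ℝ and E[f(ξ*)] ≥ E[f(εξ + ξ*)] for every ε ∈ ℝ. Then f'(ξ*)·ξ ∈ L¹(P) and the map ε ↦ E[f(εξ + ξ*)] is differentiable at ε = 0 with derivative ∂_ε|_{ε=0} E[f(εξ + ξ*)] = E[f'(ξ*) ξ] (and hence E[f'(ξ*) ξ] = 0). -/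
open MeasureTheory Filter
open scoped ENNReal Topology

/-- On `[-1, 1]` the derivative of a concave function is controlled by its increments over `[1, 2]`
and `[-2, -1]`. -/
theorem ConcaveOn.abs_deriv_le_of_mem_Icc {g : ℝ → ℝ} (hg : ConcaveOn ℝ Set.univ g)
    (hd : Differentiable ℝ g) {x : ℝ} (hx : x ∈ Set.Icc (-1 : ℝ) 1) :
    |deriv g x| ≤ |g 2 - g 1| + |g (-1) - g (-2)| := by
  have hanti := hg.antitoneOn_deriv fun y _ => hd y
  have h₁ : g 2 - g 1 ≤ deriv g 1 := by
    have := hg.slope_le_deriv (Set.mem_univ 1) (Set.mem_univ 2) (by norm_num) (hd 1)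
    norm_num [slope_def_field] at this
    linarith
  have h₂ : deriv g (-1) ≤ g (-1) - g (-2) := by
    have := hg.deriv_le_slope (Set.mem_univ (-2)) (Set.mem_univ (-1)) (by norm_num) (hd (-1))
    norm_num [slope_def_field] at this
    linarith
  have h₃ := hanti (Set.mem_univ x) (Set.mem_univ 1) hx.2
  have h₄ := hanti (Set.mem_univ (-1)) (Set.mem_univ x) hx.1
  rw [abs_le]
  constructor
  · linarith [neg_abs_le (g 2 - g 1), abs_nonneg (g (-1) - g (-2))]
  · linarith [le_abs_self (g (-1) - g (-2)), abs_nonneg (g 2 - g 1)]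

/-- If `f` is concave and `C¹`, `f(εξ + ξ*) ∈ L¹` for every `ε`, and `ξ*` maximizes
`ε ↦ E[f(εξ + ξ*)]` at `ε = 0`, then `f'(ξ*)·ξ ∈ L¹`, the map `ε ↦ E[f(εξ + ξ*)]` is
differentiable at `0` with derivative `E[f'(ξ*)ξ]`, and this derivative vanishes. -/
theorem deriv_integral_concave_at_max
    {Ω : Type*} [MeasurableSpace Ω] (P : Measure Ω) [IsProbabilityMeasure P]
    (f : ℝ → ℝ) (hf_conc : ConcaveOn ℝ Set.univ f) (hf_C1 : ContDiff ℝ 1 f)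
    (ξ ξs : Ω → ℝ) (hξ : Measurable ξ) (hξs : Measurable ξs)
    (hint : ∀ ε : ℝ, Integrable (fun ω => f (ε * ξ ω + ξs ω)) P)
    (hmax : ∀ ε : ℝ, ∫ ω, f (ε * ξ ω + ξs ω) ∂P ≤ ∫ ω, f (ξs ω) ∂P) :
    Integrable (fun ω => deriv f (ξs ω) * ξ ω) P ∧
    HasDerivAt (fun ε : ℝ => ∫ ω, f (ε * ξ ω + ξs ω) ∂P)
      (∫ ω, deriv f (ξs ω) * ξ ω ∂P) 0 ∧
    ∫ ω, deriv f (ξs ω) * ξ ω ∂P = 0 := by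
  have hfd : Differentiable ℝ f := hf_C1.differentiable one_ne_zero
  have hline : ∀ ω ε, HasDerivAt (fun ε : ℝ => f (ε * ξ ω + ξs ω))
      (deriv f (ε * ξ ω + ξs ω) * ξ ω) ε := fun ω ε => by
    have h : HasDerivAt (fun ε : ℝ => ε * ξ ω + ξs ω) (ξ ω) ε := by
      simpa using ((hasDerivAt_id ε).mul_const (ξ ω)).add_const (ξs ω)
    exact (hfd _).hasDerivAt.comp ε h
  have hconc : ∀ ω, ConcaveOn ℝ Set.univ (fun ε : ℝ => f (ε * ξ ω + ξs ω)) := fun ω => by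
    refine ⟨convex_univ, fun x _ y _ a b ha hb hab => ?_⟩
    have h := hf_conc.2 (Set.mem_univ (x * ξ ω + ξs ω)) (Set.mem_univ (y * ξ ω + ξs ω)) ha hb hab
    convert h using 2
    simp only [smul_eq_mul]
    linear_combination (-ξs ω) * hab
  have hbound : ∀ᵐ ω ∂P, ∀ ε ∈ Set.Icc (-1 : ℝ) 1, ‖deriv f (ε * ξ ω + ξs ω) * ξ ω‖ ≤
      |f (2 * ξ ω + ξs ω) - f (1 * ξ ω + ξs ω)| +
        |f (-1 * ξ ω + ξs ω) - f (-2 * ξ ω + ξs ω)| := .of_forall fun ω ε hε => by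
    have h := (hconc ω).abs_deriv_le_of_mem_Icc (fun ε => (hline ω ε).differentiableAt) hε
    rwa [(hline ω ε).deriv] at h
  have hmeas : Measurable fun ω => deriv f (0 * ξ ω + ξs ω) * ξ ω :=
    ((measurable_deriv f).comp ((hξ.const_mul 0).add hξs)).mul hξ
  obtain ⟨hi, hd⟩ := hasDerivAt_integral_of_dominated_loc_of_deriv_le
    (Icc_mem_nhds (by norm_num) (by norm_num))
    (.of_forall fun ε => (hint ε).aestronglyMeasurable) (hint 0)
    (F' := fun ε ω => deriv f (ε * ξ ω + ξs ω) * ξ ω) hmeas.aestronglyMeasurable hbound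
    (((hint 2).sub (hint 1)).abs.add ((hint (-1)).sub (hint (-2))).abs)
    (.of_forall fun ω ε _ => hline ω ε)
  simp only [zero_mul, zero_add] at hi hd
  refine ⟨hi, hd, IsLocalMax.hasDerivAt_eq_zero (.of_forall fun ε => ?_) hd⟩
  simpa using hmax ε
end

section
/- Let λ > 0 and u(x) = (1 − e^{−λx})/λ be the exponential utility, and suppose E[e^{−λG(a)}] < ∞ for every strategy a. Let a* be an essentially bounded strategy minimizing a ↦ E[e^{−λG(a)}]. Then D* := e^{−λG(a*)} / E[e^{−λG(a*)}] satisfies D* > 0 a.s., E[D*] = 1, and E[D* · DH_tⁱ | 𝔉_t] = 0 a.s. for all t, i; moreover D* minimizes the relative entropy E[D log D] among all equivalent martingale densities D (i.e., D > 0 a.s., E[D] = 1, E[D·DH_tⁱ | 𝔉_t] = 0 for all t, i), so Q* with dQ* = D* dP is the minimal entropy martingale measure. -/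
open MeasureTheory Filter Real
open scoped ENNReal Topology

section

variable {Ω : Type*} [mΩ : MeasurableSpace Ω] {n : ℕ}

/-- A trading strategy is adapted: `a t` is `ℱ t`-measurable for each `t`. -/
def IsStrategy (ℱ : ℕ → MeasurableSpace Ω) (a : ℕ → Ω → Fin n → ℝ) : Prop :=
  ∀ t, Measurable[ℱ t] (a t)

/-- Terminal gains `G(a) = ∑_{t<m} a_t · DH_t` with `DH_t = H_T^{(t)} - H_t^{(t)}`. -/
def gains (m : ℕ) (Hmid HT : ℕ → Ω → Fin n → ℝ) (a : ℕ → Ω → Fin n → ℝ) (ω : Ω) : ℝ :=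
  ∑ t ∈ Finset.range m, ∑ i, a t ω i * (HT t ω i - Hmid t ω i)

/-- An essentially bounded strategy. -/
def EssBdd (P : Measure Ω) (a : ℕ → Ω → Fin n → ℝ) : Prop :=
  ∀ t, ∃ C : ℝ, ∀ᵐ ω ∂P, ∀ i, |a t ω i| ≤ C

/-- First-order condition for an exponential integral: if `ε ↦ E[exp (f + ε Y)]` is finite
everywhere and minimal at `ε = 0`, then `E[exp f · Y] = 0`. -/
lemma integral_exp_mul_eq_zero_of_forall_le {P : Measure Ω} [NeZero P] {f Y : Ω → ℝ}
    (hfin : ∀ ε : ℝ, Integrable (fun ω => exp (f ω + ε * Y ω)) P)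
    (hmin : ∀ ε : ℝ, ∫ ω, exp (f ω) ∂P ≤ ∫ ω, exp (f ω + ε * Y ω) ∂P) :
    Integrable (fun ω => exp (f ω) * Y ω) P ∧ ∫ ω, exp (f ω) * Y ω ∂P = 0 := by
  have hf : Integrable (fun ω => exp (f ω)) P := by simpa using hfin 0
  have hpos : 0 < ∫ ω, exp (f ω) ∂P := integral_exp_pos hf
  have hset : ProbabilityTheory.integrableExpSet Y (P.tilted f) = Set.univ := by
    refine Set.eq_univ_of_forall fun ε => ?_
    refine (integrable_tilted_iff hf _).2 ?_
    simpa only [smul_eq_mul, ← exp_add] using hfin ε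
  have h0 : (0 : ℝ) ∈ interior (ProbabilityTheory.integrableExpSet Y (P.tilted f)) := by
    simp [hset]
  have hYint : Integrable Y (P.tilted f) :=
    memLp_one_iff_integrable.1
      (ProbabilityTheory.memLp_of_mem_interior_integrableExpSet h0 1)
  have hmgf (ε : ℝ) : ProbabilityTheory.mgf Y (P.tilted f) ε
      = (∫ ω, exp (f ω + ε * Y ω) ∂P) / ∫ ω, exp (f ω) ∂P :=
    integral_exp_tilted f fun ω => ε * Y ω
  have hlocal : IsLocalMin (ProbabilityTheory.mgf Y (P.tilted f)) 0 := by
    refine Eventually.of_forall fun ε => ?_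
    simp only [hmgf, zero_mul, add_zero]
    exact div_le_div_of_nonneg_right (hmin ε) hpos.le
  have hzero : ∫ ω, Y ω ∂(P.tilted f) = 0 := by
    rw [← ProbabilityTheory.deriv_mgf_zero h0, hlocal.deriv_eq_zero]
  refine ⟨by simpa only [smul_eq_mul] using (integrable_tilted_iff hf Y).1 hYint, ?_⟩
  simp_rw [integral_tilted, smul_eq_mul, div_mul_eq_mul_div, integral_div] at hzero
  exact (div_eq_zero_iff.1 hzero).resolve_right hpos.ne'

/-- A bounded `m`-measurable factor preserves vanishing of the conditional expectation. -/
lemma integral_mul_eq_zero_of_condExp_eq_zero {P : Measure Ω} [IsFiniteMeasure P]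
    {m : MeasurableSpace Ω} (hm : m ≤ mΩ) {f g : Ω → ℝ} {C : ℝ} (hf : Measurable[m] f)
    (hfC : ∀ᵐ ω ∂P, |f ω| ≤ C) (hg : Integrable g P) (hg0 : P[g|m] =ᵐ[P] fun _ => (0 : ℝ)) :
    Integrable (fun ω => f ω * g ω) P ∧ ∫ ω, f ω * g ω ∂P = 0 := by
  have hfg : Integrable (fun ω => f ω * g ω) P :=
    hg.bdd_mul (hf.mono hm le_rfl).aestronglyMeasurable hfC
  refine ⟨hfg, ?_⟩
  rw [← integral_condExp hm]
  refine integral_eq_zero_of_ae ?_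
  filter_upwards [condExp_mul_of_stronglyMeasurable_left hf.stronglyMeasurable hfg hg, hg0]
    with ω h h0
  exact h.trans (by simp [h0])

/-- Bounded strategies have zero expected gains under a martingale density. -/
lemma integral_mul_gains_eq_zero {P : Measure Ω} [IsFiniteMeasure P] {m : ℕ}
    {ℱ : ℕ → MeasurableSpace Ω} (hℱ : ∀ t, ℱ t ≤ mΩ) {Hmid HT a : ℕ → Ω → Fin n → ℝ}
    (ha : IsStrategy ℱ a) (hbdd : EssBdd P a) {D : Ω → ℝ}
    (hD : ∀ t, t < m → ∀ i,
      Integrable (fun ω => D ω * (HT t ω i - Hmid t ω i)) P ∧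
      P[fun ω => D ω * (HT t ω i - Hmid t ω i)|ℱ t] =ᵐ[P] fun _ => (0 : ℝ)) :
    Integrable (fun ω => D ω * gains m Hmid HT a ω) P ∧
      ∫ ω, D ω * gains m Hmid HT a ω ∂P = 0 := by
  have key (t : ℕ) (ht : t ∈ Finset.range m) (i : Fin n) :
      Integrable (fun ω => a t ω i * (D ω * (HT t ω i - Hmid t ω i))) P ∧
        ∫ ω, a t ω i * (D ω * (HT t ω i - Hmid t ω i)) ∂P = 0 := by
    obtain ⟨C, hC⟩ := hbdd t
    obtain ⟨h, h0⟩ := hD t (Finset.mem_range.1 ht) i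
    exact integral_mul_eq_zero_of_condExp_eq_zero (hℱ t)
      ((measurable_pi_apply i).comp (ha t)) (hC.mono fun ω hω => hω i) h h0
  have hsum : (fun ω => D ω * gains m Hmid HT a ω) = fun ω =>
      ∑ t ∈ Finset.range m, ∑ i, a t ω i * (D ω * (HT t ω i - Hmid t ω i)) := by
    ext ω
    simp only [gains, Finset.mul_sum]
    exact Finset.sum_congr rfl fun t _ => Finset.sum_congr rfl fun i _ => by ring
  rw [hsum]
  have hfin (t : ℕ) (ht : t ∈ Finset.range m) :
      Integrable (fun ω => ∑ i, a t ω i * (D ω * (HT t ω i - Hmid t ω i))) P :=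
    integrable_finsetSum _ fun i _ => (key t ht i).1
  refine ⟨integrable_finsetSum _ hfin, ?_⟩
  rw [integral_finsetSum _ hfin]
  refine Finset.sum_eq_zero fun t ht => ?_
  rw [integral_finsetSum _ fun i _ => (key t ht i).1]
  exact Finset.sum_eq_zero fun i _ => (key t ht i).2

/-- Perturb the `i`-th position of a strategy at time `t` by `ε` on the event `A`. -/
noncomputable def perturb (a : ℕ → Ω → Fin n → ℝ) (t : ℕ) (i : Fin n) (A : Set Ω) (ε : ℝ) :
    ℕ → Ω → Fin n → ℝ :=
  fun s ω j => a s ω j + if s = t then (if j = i then A.indicator (fun _ => ε) ω else 0) else 0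

omit mΩ in
lemma IsStrategy.perturb {ℱ : ℕ → MeasurableSpace Ω} {a : ℕ → Ω → Fin n → ℝ}
    (ha : IsStrategy ℱ a) (t : ℕ) (i : Fin n) {A : Set Ω} (hA : MeasurableSet[ℱ t] A) (ε : ℝ) :
    IsStrategy ℱ (perturb a t i A ε) := by
  intro s
  refine @measurable_pi_lambda Ω (Fin n) (fun _ => ℝ) (ℱ s) _ _ fun j =>
    Measurable.add (m := ℱ s) ((measurable_pi_apply j).comp (ha s)) ?_
  split_ifs with hs hj
  · subst hs
    exact measurable_const.indicator hA
  · exact measurable_const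
  · exact measurable_const

omit mΩ in
lemma gains_perturb {m : ℕ} (Hmid HT a : ℕ → Ω → Fin n → ℝ) {t : ℕ} (ht : t < m) (i : Fin n)
    (A : Set Ω) (ε : ℝ) (ω : Ω) :
    gains m Hmid HT (perturb a t i A ε) ω
      = gains m Hmid HT a ω + ε * A.indicator (fun ω => HT t ω i - Hmid t ω i) ω := by
  simp only [gains, perturb, add_mul, Finset.sum_add_distrib, ite_mul, zero_mul]
  congr 1
  rw [Finset.sum_eq_single_of_mem t (Finset.mem_range.2 ht) fun s _ hs => by simp [hs]]
  by_cases hω : ω ∈ A <;> simp [hω]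

/-- The exponential density of an optimal strategy prices every instrument return at zero. -/
lemma condExp_exp_gains_eq_zero {P : Measure Ω} [IsProbabilityMeasure P] {m : ℕ}
    {ℱ : ℕ → MeasurableSpace Ω} (hℱ : ∀ t, ℱ t ≤ mΩ) {Hmid HT a : ℕ → Ω → Fin n → ℝ}
    {lam : ℝ} (hlam : lam ≠ 0)
    (hexp_int : ∀ b : ℕ → Ω → Fin n → ℝ, IsStrategy ℱ b →
      Integrable (fun ω => exp (-lam * gains m Hmid HT b ω)) P)
    (ha : IsStrategy ℱ a)
    (hmin : ∀ b : ℕ → Ω → Fin n → ℝ, IsStrategy ℱ b →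
      ∫ ω, exp (-lam * gains m Hmid HT a ω) ∂P ≤ ∫ ω, exp (-lam * gains m Hmid HT b ω) ∂P)
    {t : ℕ} (ht : t < m) (i : Fin n) :
    Integrable (fun ω => exp (-lam * gains m Hmid HT a ω) * (HT t ω i - Hmid t ω i)) P ∧
      P[fun ω => exp (-lam * gains m Hmid HT a ω) * (HT t ω i - Hmid t ω i)|ℱ t]
        =ᵐ[P] fun _ => (0 : ℝ) := by
  have key (A : Set Ω) (hA : MeasurableSet[ℱ t] A) :
      Integrable (fun ω => exp (-lam * gains m Hmid HT a ω)
        * A.indicator (fun ω => HT t ω i - Hmid t ω i) ω) P ∧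
      ∫ ω, exp (-lam * gains m Hmid HT a ω)
        * A.indicator (fun ω => HT t ω i - Hmid t ω i) ω ∂P = 0 := by
    have hperturb (ε : ℝ) (ω : Ω) : -lam * gains m Hmid HT a ω
          + ε * A.indicator (fun ω => HT t ω i - Hmid t ω i) ω
        = -lam * gains m Hmid HT (perturb a t i A (-ε / lam)) ω := by
      rw [gains_perturb Hmid HT a ht]
      field_simp
      ring
    refine integral_exp_mul_eq_zero_of_forall_le (fun ε => ?_) fun ε => ?_
    · simpa only [hperturb] using hexp_int _ (ha.perturb t i hA _)
    · simpa only [hperturb] using hmin _ (ha.perturb t i hA _)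
  have hfin : Integrable
      (fun ω => exp (-lam * gains m Hmid HT a ω) * (HT t ω i - Hmid t ω i)) P := by
    simpa using (key Set.univ MeasurableSet.univ).1
  refine ⟨hfin, (ae_eq_condExp_of_forall_setIntegral_eq (hℱ t) hfin
    (fun _ _ _ => integrableOn_zero) (fun A hA _ => ?_) aestronglyMeasurable_const).symm⟩
  rw [integral_zero, ← integral_indicator (hℱ t A hA)]
  simp_rw [Set.indicator_mul_right, (key A hA).2]

/-- The Gibbs variational inequality for densities, pointwise form. -/
lemma sub_le_mul_log_sub_mul_log {x y : ℝ} (hx : 0 < x) (hy : 0 < y) :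
    x - y ≤ x * log x - x * log y := by
  have h := mul_le_mul_of_nonneg_left (one_sub_inv_le_log_of_pos (div_pos hx hy)) hx.le
  rw [log_div hx.ne' hy.ne', inv_div, mul_sub, mul_sub, mul_div_cancel₀ _ hx.ne'] at h
  simpa using h

/-- For the exponential utility, the density
`D* = e^{-λG(a*)} / E[e^{-λG(a*)}]` of the optimizer `a*` is an equivalent
martingale density and minimizes the relative entropy `E[D log D]` among all
equivalent martingale densities: it yields the minimal entropy martingale measure. -/
theorem minimal_entropy_martingale_measure
    (P : Measure Ω) [IsProbabilityMeasure P] (m : ℕ)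
    (ℱ : ℕ → MeasurableSpace Ω) (hℱ : ∀ t, ℱ t ≤ mΩ) (hℱmono : Monotone ℱ)
    (Hmid HT : ℕ → Ω → Fin n → ℝ)
    (hHmid_meas : ∀ t, t < m → Measurable[ℱ t] (Hmid t))
    (hHT_meas : ∀ t, t < m → Measurable (HT t))
    (hHmid_int : ∀ t, t < m → ∀ i, Integrable (fun ω => Hmid t ω i) P)
    (hHT_int : ∀ t, t < m → ∀ i, Integrable (fun ω => HT t ω i) P)
    (lam : ℝ) (hlam : 0 < lam)
    (u : ℝ → ℝ) (hu : ∀ x, u x = (1 - Real.exp (-lam * x)) / lam)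
    (hexp_int : ∀ a : ℕ → Ω → Fin n → ℝ, IsStrategy ℱ a →
      Integrable (fun ω => Real.exp (-lam * gains m Hmid HT a ω)) P)
    -- the minimizer of `a ↦ E[e^{-λ G(a)}]`
    (astar : ℕ → Ω → Fin n → ℝ)
    (hastar : IsStrategy ℱ astar) (hastar_bdd : EssBdd P astar)
    (hmin : ∀ a : ℕ → Ω → Fin n → ℝ, IsStrategy ℱ a →
      (∫ ω, Real.exp (-lam * gains m Hmid HT astar ω) ∂P)
        ≤ ∫ ω, Real.exp (-lam * gains m Hmid HT a ω) ∂P)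
    (D : Ω → ℝ)
    (hD : ∀ ω, D ω = Real.exp (-lam * gains m Hmid HT astar ω)
        / ∫ ω', Real.exp (-lam * gains m Hmid HT astar ω') ∂P) :
    -- positivity and unit expectation
    (∀ᵐ ω ∂P, 0 < D ω) ∧
    Integrable D P ∧ (∫ ω, D ω ∂P) = 1 ∧
    -- equivalent martingale density property
    (∀ t, t < m → ∀ i,
      Integrable (fun ω => D ω * (HT t ω i - Hmid t ω i)) P ∧
      P[fun ω => D ω * (HT t ω i - Hmid t ω i)|ℱ t] =ᵐ[P] fun _ => (0 : ℝ)) ∧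
    -- minimal relative entropy among all equivalent martingale densities
    Integrable (fun ω => D ω * Real.log (D ω)) P ∧
    (∀ D' : Ω → ℝ, Measurable D' →
      (∀ᵐ ω ∂P, 0 < D' ω) →
      Integrable D' P → (∫ ω, D' ω ∂P) = 1 →
      (∀ t, t < m → ∀ i,
        Integrable (fun ω => D' ω * (HT t ω i - Hmid t ω i)) P ∧
        P[fun ω => D' ω * (HT t ω i - Hmid t ω i)|ℱ t] =ᵐ[P] fun _ => (0 : ℝ)) →
      Integrable (fun ω => D' ω * Real.log (D' ω)) P →
      (∫ ω, D ω * Real.log (D ω) ∂P) ≤ ∫ ω, D' ω * Real.log (D' ω) ∂P) := by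
  set Z := ∫ ω, exp (-lam * gains m Hmid HT astar ω) ∂P with hZ
  have hfin := hexp_int astar hastar
  have hZpos : 0 < Z := integral_exp_pos hfin
  obtain rfl : D = fun ω => exp (-lam * gains m Hmid HT astar ω) / Z := funext hD
  have hpos (ω : Ω) : 0 < exp (-lam * gains m Hmid HT astar ω) / Z := by positivity
  have hDint : Integrable (fun ω => exp (-lam * gains m Hmid HT astar ω) / Z) P :=
    hfin.div_const Z
  have hDone : ∫ ω, exp (-lam * gains m Hmid HT astar ω) / Z ∂P = 1 := by
    rw [integral_div, ← hZ, div_self hZpos.ne']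
  have hmart (t : ℕ) (ht : t < m) (i : Fin n) :
      Integrable (fun ω => exp (-lam * gains m Hmid HT astar ω) / Z
        * (HT t ω i - Hmid t ω i)) P ∧
      P[fun ω => exp (-lam * gains m Hmid HT astar ω) / Z * (HT t ω i - Hmid t ω i)|ℱ t]
        =ᵐ[P] fun _ => (0 : ℝ) := by
    obtain ⟨h, h0⟩ := condExp_exp_gains_eq_zero hℱ hlam.ne' hexp_int hastar hmin ht i
    have heq : (fun ω => exp (-lam * gains m Hmid HT astar ω) / Z * (HT t ω i - Hmid t ω i))
        = Z⁻¹ • fun ω => exp (-lam * gains m Hmid HT astar ω) * (HT t ω i - Hmid t ω i) := by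
      ext ω
      simp only [Pi.smul_apply, smul_eq_mul]
      ring
    rw [heq]
    refine ⟨h.smul _, ?_⟩
    filter_upwards [condExp_smul Z⁻¹
      (fun ω => exp (-lam * gains m Hmid HT astar ω) * (HT t ω i - Hmid t ω i)) (ℱ t), h0]
      with ω hω hω0
    rw [hω, Pi.smul_apply, hω0, smul_zero]
  have hlog (ω : Ω) : log (exp (-lam * gains m Hmid HT astar ω) / Z)
      = -lam * gains m Hmid HT astar ω - log Z := by
    rw [log_div (exp_ne_zero _) hZpos.ne', log_exp]
  -- every martingale density has the same cross entropy relative to the optimal one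
  have hcross (E : Ω → ℝ) (hE : Integrable E P) (hE1 : ∫ ω, E ω ∂P = 1)
      (hEmart : ∀ t, t < m → ∀ i,
        Integrable (fun ω => E ω * (HT t ω i - Hmid t ω i)) P ∧
        P[fun ω => E ω * (HT t ω i - Hmid t ω i)|ℱ t] =ᵐ[P] fun _ => (0 : ℝ)) :
      Integrable (fun ω => E ω * log (exp (-lam * gains m Hmid HT astar ω) / Z)) P ∧
        ∫ ω, E ω * log (exp (-lam * gains m Hmid HT astar ω) / Z) ∂P = -log Z := by
    obtain ⟨h, h0⟩ := integral_mul_gains_eq_zero hℱ hastar hastar_bdd hEmart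
    have heq : (fun ω => E ω * log (exp (-lam * gains m Hmid HT astar ω) / Z))
        = fun ω => -lam * (E ω * gains m Hmid HT astar ω) - log Z * E ω := by
      ext ω
      rw [hlog]
      ring
    rw [heq]
    refine ⟨(h.const_mul _).sub (hE.const_mul _), ?_⟩
    rw [integral_sub (h.const_mul _) (hE.const_mul _), integral_const_mul, integral_const_mul,
      h0, hE1]
    ring
  obtain ⟨hDlog, hDlog_eq⟩ := hcross _ hDint hDone hmart
  refine ⟨ae_of_all _ hpos, hDint, hDone, hmart, hDlog, ?_⟩
  intro D' _ hD'pos hD'int hD'one hD'mart hD'log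
  obtain ⟨hc, hc_eq⟩ := hcross D' hD'int hD'one hD'mart
  have hle := integral_mono_ae (hD'int.sub hDint) (hD'log.sub hc)
    (hD'pos.mono fun ω hω => sub_le_mul_log_sub_mul_log hω (hpos ω))
  rw [integral_sub' hD'int hDint, integral_sub' hD'log hc, hD'one, hDone, hc_eq] at hle
  rw [hDlog_eq]
  linarith

end
end

section
/- Let (c_t) be generalized cost functions with marginal costs γ_tⁱ⁺ := ∂_{ε↓0} c_t(ε eⁱ) and γ_tⁱ⁻ := ∂_{ε↓0} c_t(−ε eⁱ), marginal cost functions m_t(a) := a⁺ · γ_t⁺ + a⁻ · γ_t⁻, and assume c_t(a) ≥ m_t(a) for all a and t. Let Q be a probability measure equivalent to P with every DH_tⁱ ∈ L¹(Q). Then the following are equivalent: (i) Q is free of statistical arbitrage with full cost c, i.e., E_Q[G(a) − Σ_t c_t(a_t)] ≤ 0 for every essentially bounded strategy a; (ii) Q is free of statistical arbitrage with marginal cost m, i.e., E_Q[G(a) − Σ_t m_t(a_t)] ≤ 0 for every essentially bounded strategy a; (iii) for every t and every coordinate i, −γ_tⁱ⁻ ≤ E_Q[DH_tⁱ | 𝔉_t]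 ≤ γ_tⁱ⁺ almost surely, i.e., the conditional expectation of each instrument's terminal value lies within its marginal bid/ask spread: H_t^{(t,i)} − γ_tⁱ⁻ ≤ E_Q[H_T^{(t,i)} | 𝔉_t] ≤ H_t^{(t,i)} + γ_tⁱ⁺. -/
open MeasureTheory Filter
open scoped ENNReal Topology

section

variable {Ω : Type*} [mΩ : MeasurableSpace Ω] {n : ℕ}

/-- The marginal cost function `m(a) = a⁺ · γ⁺ + a⁻ · γ⁻`. -/
def mcost (γp γm : Ω → Fin n → ℝ) (ω : Ω) (a : Fin n → ℝ) : ℝ :=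
  ∑ i, (max (a i) 0 * γp ω i + max (-a i) 0 * γm ω i)

/-- The real integral of a function is at most the extended integral of its positive part. -/
lemma coe_integral_le_lintegral_ofReal {μ : Measure Ω} {h : Ω → ℝ} (hh : Integrable h μ) :
    ((∫ ω, h ω ∂μ : ℝ) : EReal) ≤ ((∫⁻ ω, ENNReal.ofReal (h ω) ∂μ : ℝ≥0∞) : EReal) := by
  have hfin : ∫⁻ ω, ENNReal.ofReal (h ω) ∂μ ≠ ∞ := hh.lintegral_lt_top.ne
  rw [integral_eq_lintegral_pos_part_sub_lintegral_neg_part hh,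
    ← EReal.coe_ennreal_toReal hfin, EReal.coe_le_coe_iff]
  exact sub_le_self _ ENNReal.toReal_nonneg

lemma mcost_nonneg {Ω : Type*} {γp γm : Ω → Fin n → ℝ} {ω : Ω} (hp : ∀ i, 0 ≤ γp ω i)
    (hm : ∀ i, 0 ≤ γm ω i) (a : Fin n → ℝ) : 0 ≤ mcost γp γm ω a :=
  Finset.sum_nonneg fun i _ => add_nonneg
    (mul_nonneg (le_max_right _ _) (hp i)) (mul_nonneg (le_max_right _ _) (hm i))

lemma mul_le_max_mul_add_max_mul {x y p q : ℝ} (hq : -q ≤ y) (hp : y ≤ p) :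
    x * y ≤ max x 0 * p + max (-x) 0 * q := by
  rcases le_total 0 x with hx | hx
  · rw [max_eq_left hx, max_eq_right (neg_nonpos.mpr hx)]
    nlinarith
  · rw [max_eq_right hx, max_eq_left (neg_nonneg.mpr hx)]
    nlinarith

/-- A bounded `𝒢`-measurable factor may be integrated against the conditional expectation. -/
lemma integral_mul_condExp_of_bdd {μ : Measure Ω} [IsProbabilityMeasure μ]
    {𝒢 : MeasurableSpace Ω} (h𝒢 : 𝒢 ≤ mΩ) {b D : Ω → ℝ} (hb : Measurable[𝒢] b) {C : ℝ}
    (hbC : ∀ᵐ ω ∂μ, |b ω| ≤ C) (hD : Integrable D μ) :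
    ∫ ω, b ω * (μ[D|𝒢]) ω ∂μ = ∫ ω, b ω * D ω ∂μ := by
  have hbD : Integrable (b * D) μ :=
    hD.bdd_mul (hb.mono h𝒢 le_rfl).aestronglyMeasurable hbC
  calc ∫ ω, b ω * (μ[D|𝒢]) ω ∂μ = ∫ ω, (μ[b * D|𝒢]) ω ∂μ :=
        integral_congr_ae
          (condExp_mul_of_stronglyMeasurable_left hb.stronglyMeasurable hbD hD).symm
    _ = ∫ ω, b ω * D ω ∂μ := integral_condExp h𝒢

/-- If, on every `𝒢`-measurable event, the gain of `ε k` units of `D` is on average no larger than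
its cost `C k`, then the conditional expectation of `D` is bounded by the limit of `C k / ε k`. -/
lemma condExp_le_of_tendsto_cost {μ : Measure Ω} [IsProbabilityMeasure μ]
    {𝒢 : MeasurableSpace Ω} (h𝒢 : 𝒢 ≤ mΩ) {D : Ω → ℝ} (hD : Integrable D μ) {ε : ℕ → ℝ} (hε : ∀ k, 0 < ε k)
    {C : ℕ → Ω → ℝ≥0∞} (hC : ∀ k, Measurable[𝒢] (C k)) {γ : Ω → ℝ} (hγ : ∀ ω, 0 ≤ γ ω)
    (hlim : ∀ ω, Tendsto (fun k => C k ω / ENNReal.ofReal (ε k)) atTop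
      (𝓝 (ENNReal.ofReal (γ ω))))
    (hle : ∀ k A, MeasurableSet[𝒢] A →
      ((∫ ω in A, ε k * D ω ∂μ : ℝ) : EReal) ≤ ((∫⁻ ω in A, C k ω ∂μ : ℝ≥0∞) : EReal)) :
    ∀ᵐ ω ∂μ, (μ[D|𝒢]) ω ≤ γ ω := by
  set X := μ[D|𝒢] with hX
  have hXm : Measurable[𝒢] X := stronglyMeasurable_condExp.measurable
  let B : ℕ → Set Ω := fun k => {ω | C k ω < ENNReal.ofReal (ε k * X ω)}
  have hBm : ∀ k, MeasurableSet[𝒢] (B k) := fun k =>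
    measurableSet_lt (hC k) (hXm.const_mul (ε k)).ennreal_ofReal
  have hB0 : ∀ k, μ (B k) = 0 := by
    intro k
    have hBm' := h𝒢 _ (hBm k)
    have hint : Integrable (fun ω => ε k * X ω) μ := integrable_condExp.const_mul _
    have hpos : ∀ᵐ ω ∂μ.restrict (B k), 0 ≤ ε k * X ω := by
      refine (ae_restrict_iff' hBm').2 (Eventually.of_forall fun ω hω => ?_)
      exact (ENNReal.ofReal_pos.1 (pos_of_gt hω)).le
    have hlt : ∀ᵐ ω ∂μ.restrict (B k), C k ω < ENNReal.ofReal (ε k * X ω) :=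
      (ae_restrict_iff' hBm').2 (Eventually.of_forall fun ω hω => hω)
    have hfin : ∫⁻ ω in B k, ENNReal.ofReal (ε k * X ω) ∂μ ≠ ∞ :=
      hint.integrableOn.lintegral_lt_top.ne
    have hgain : ∫⁻ ω in B k, ENNReal.ofReal (ε k * X ω) ∂μ ≤ ∫⁻ ω in B k, C k ω ∂μ := by
      have h1 := hle k (B k) (hBm k)
      rw [integral_const_mul, ← setIntegral_condExp h𝒢 hD (hBm k), ← integral_const_mul,
        integral_eq_lintegral_of_nonneg_ae hpos hint.integrableOn.aestronglyMeasurable,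
        EReal.coe_ennreal_toReal hfin] at h1
      exact EReal.coe_ennreal_le_coe_ennreal_iff.1 h1
    have heq := ae_eq_of_ae_le_of_lintegral_le (hlt.mono fun ω h => h.le)
      (ne_top_of_le_ne_top hfin (lintegral_mono_ae (hlt.mono fun ω h => h.le)))
      ((hXm.const_mul (ε k)).ennreal_ofReal.mono h𝒢 le_rfl).aemeasurable hgain
    have hfalse : ∀ᵐ ω ∂μ.restrict (B k), False := by
      filter_upwards [heq, hlt] with ω h1 h2 using h2.ne h1
    rw [ae_iff] at hfalse
    simpa using hfalse
  filter_upwards [ae_all_iff.2 fun k => measure_eq_zero_iff_ae_notMem.1 (hB0 k)] with ω hω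
  by_contra! hlt
  have hX0 : 0 < X ω := (hγ ω).trans_lt hlt
  obtain ⟨k, hk⟩ := ((hlim ω).eventually_lt_const
    ((ENNReal.ofReal_lt_ofReal_iff hX0).2 hlt)).exists
  refine hω k ?_
  have hεk := ENNReal.ofReal_pos.2 (hε k)
  rw [ENNReal.div_lt_iff (Or.inl hεk.ne') (Or.inl ENNReal.ofReal_ne_top), mul_comm,
    ← ENNReal.ofReal_mul (hε k).le] at hk
  exact hk

/-- Holding `δ` units of the `i`-th instrument from time `t` on the event `A`, the absence of
statistical arbitrage bounds the average gain on `A` by the average cost on `A`. -/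
lemma setIntegral_gain_le_setLIntegral_cost {μ : Measure Ω} {m : ℕ} {ℱ : ℕ → MeasurableSpace Ω}
    (hℱ : ∀ t, ℱ t ≤ mΩ) {Hmid HT : ℕ → Ω → Fin n → ℝ} {c : ℕ → Ω → (Fin n → ℝ) → ℝ≥0∞}
    (hc0 : ∀ t ω, c t ω 0 = 0)
    (h : ∀ a : ℕ → Ω → Fin n → ℝ, IsStrategy ℱ a → EssBdd μ a →
        ((∫ ω, gains m Hmid HT a ω ∂μ : ℝ) : EReal)
          ≤ ((∫⁻ ω, ∑ t ∈ Finset.range m, c t ω (a t ω) ∂μ : ℝ≥0∞) : EReal))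
    {t : ℕ} (ht : t < m) (i : Fin n) (δ : ℝ) {A : Set Ω} (hA : MeasurableSet[ℱ t] A) :
    ((∫ ω in A, δ * (HT t ω i - Hmid t ω i) ∂μ : ℝ) : EReal)
      ≤ ((∫⁻ ω in A, c t ω (fun j => if j = i then δ else 0) ∂μ : ℝ≥0∞) : EReal) := by
  classical
  let v : Fin n → ℝ := fun j => if j = i then δ else 0
  let a : ℕ → Ω → Fin n → ℝ := fun s => if s = t then A.indicator (fun _ => v) else 0
  have hat : a t = A.indicator (fun _ => v) := if_pos rfl
  have has : ∀ s, s ≠ t → a s = 0 := fun s hs => if_neg hs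
  have hstrat : IsStrategy ℱ a := by
    intro s
    by_cases hs : s = t
    · subst hs
      rw [hat]
      exact measurable_const.indicator hA
    · rw [has s hs]
      exact measurable_const
  have hbdd : EssBdd μ a := by
    refine fun s => ⟨|δ|, Eventually.of_forall fun ω j => ?_⟩
    by_cases hs : s = t
    · subst hs
      rw [hat]
      by_cases hω : ω ∈ A
      · by_cases hj : j = i <;> simp [hω, v, hj]
      · simp [hω]
    · simp [has s hs]
  have hgain : gains m Hmid HT a = A.indicator fun ω => δ * (HT t ω i - Hmid t ω i) := by
    funext ω
    unfold gains
    rw [Finset.sum_eq_single_of_mem t (Finset.mem_range.2 ht)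
      fun s _ hs => by simp [has s hs], hat]
    by_cases hω : ω ∈ A <;> simp [hω, v]
  have hcost : (fun ω => ∑ s ∈ Finset.range m, c s ω (a s ω)) =
      A.indicator fun ω => c t ω v := by
    funext ω
    rw [Finset.sum_eq_single_of_mem t (Finset.mem_range.2 ht)
      fun s _ hs => by simp [has s hs, hc0], hat]
    by_cases hω : ω ∈ A <;> simp [hω, hc0]
  have := h a hstrat hbdd
  rwa [hgain, hcost, integral_indicator (hℱ t _ hA), lintegral_indicator (hℱ t _ hA)] at this

/-- Under a near-martingale measure the average gain of a bounded strategy does not exceed its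
average marginal cost. -/
lemma integral_gains_le_lintegral_mcost {μ : Measure Ω} [IsProbabilityMeasure μ] {m : ℕ}
    {ℱ : ℕ → MeasurableSpace Ω} (hℱ : ∀ t, ℱ t ≤ mΩ) {Hmid HT γp γm : ℕ → Ω → Fin n → ℝ}
    (hint : ∀ t, t < m → ∀ i, Integrable (fun ω => HT t ω i - Hmid t ω i) μ)
    (h : ∀ t, t < m → ∀ i, ∀ᵐ ω ∂μ,
      -(γm t ω i) ≤ (μ[fun ω' => HT t ω' i - Hmid t ω' i|ℱ t]) ω ∧
      (μ[fun ω' => HT t ω' i - Hmid t ω' i|ℱ t]) ω ≤ γp t ω i)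
    {a : ℕ → Ω → Fin n → ℝ} (ha : IsStrategy ℱ a) (hab : EssBdd μ a) :
    ((∫ ω, gains m Hmid HT a ω ∂μ : ℝ) : EReal)
      ≤ ((∫⁻ ω, ENNReal.ofReal
            (∑ t ∈ Finset.range m, mcost (γp t) (γm t) ω (a t ω)) ∂μ : ℝ≥0∞) : EReal) := by
  let X : ℕ → Fin n → Ω → ℝ := fun t i => μ[fun ω' => HT t ω' i - Hmid t ω' i|ℱ t]
  have hcoord : ∀ t i, Measurable[ℱ t] fun ω => a t ω i := fun t i =>
    (measurable_pi_apply i).comp (ha t)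
  have hmulint : ∀ t i {f : Ω → ℝ}, Integrable f μ → Integrable (fun ω => a t ω i * f ω) μ := by
    intro t i f hf
    obtain ⟨C, hC⟩ := hab t
    exact hf.bdd_mul ((hcoord t i).mono (hℱ t) le_rfl).aestronglyMeasurable
      (hC.mono fun ω hω => hω i)
  have hXint : ∀ t i, Integrable (fun ω => a t ω i * X t i ω) μ := fun t i =>
    hmulint t i integrable_condExp
  have heq : ∫ ω, gains m Hmid HT a ω ∂μ
      = ∫ ω, ∑ t ∈ Finset.range m, ∑ i, a t ω i * X t i ω ∂μ := by
    unfold gains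
    rw [integral_finsetSum _ fun t ht => integrable_finsetSum _ fun i _ =>
        hmulint t i (hint t (Finset.mem_range.1 ht) i),
      integral_finsetSum _ fun t _ => integrable_finsetSum _ fun i _ => hXint t i]
    refine Finset.sum_congr rfl fun t ht => ?_
    rw [integral_finsetSum _ fun i _ => hmulint t i (hint t (Finset.mem_range.1 ht) i),
      integral_finsetSum _ fun i _ => hXint t i]
    refine Finset.sum_congr rfl fun i _ => ?_
    obtain ⟨C, hC⟩ := hab t
    exact (integral_mul_condExp_of_bdd (hℱ t) (hcoord t i) (hC.mono fun ω hω => hω i)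
      (hint t (Finset.mem_range.1 ht) i)).symm
  rw [heq]
  refine (coe_integral_le_lintegral_ofReal (integrable_finsetSum _ fun t _ =>
    integrable_finsetSum _ fun i _ => hXint t i)).trans ?_
  rw [EReal.coe_ennreal_le_coe_ennreal_iff]
  have hall : ∀ᵐ ω ∂μ, ∀ t, t < m → ∀ i, -(γm t ω i) ≤ X t i ω ∧ X t i ω ≤ γp t ω i := by
    simp only [ae_all_iff]
    exact h
  refine lintegral_mono_ae (hall.mono fun ω hω => ENNReal.ofReal_le_ofReal ?_)
  refine Finset.sum_le_sum fun t ht => Finset.sum_le_sum fun i _ => ?_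
  obtain ⟨hl, hu⟩ := hω t (Finset.mem_range.1 ht) i
  exact mul_le_max_mul_add_max_mul hl hu

/-- Equivalence of: (i) no statistical arbitrage with full cost `c`, (ii) no
statistical arbitrage with marginal cost `m`, (iii) the conditional expected
return of every instrument lies within its marginal bid/ask spread (`Q` is a
near-martingale measure). -/
theorem no_statistical_arbitrage_iff_near_martingale
    (P Q : Measure Ω) [IsProbabilityMeasure P] [IsProbabilityMeasure Q]
    (hQP : Q ≪ P) (hPQ : P ≪ Q)
    (m : ℕ)
    (ℱ : ℕ → MeasurableSpace Ω) (hℱ : ∀ t, ℱ t ≤ mΩ) (hℱmono : Monotone ℱ)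
    (Hmid HT : ℕ → Ω → Fin n → ℝ)
    (hHmid_meas : ∀ t, t < m → Measurable[ℱ t] (Hmid t))
    (hHT_meas : ∀ t, t < m → Measurable (HT t))
    (hHmid_int : ∀ t, t < m → ∀ i, Integrable (fun ω => Hmid t ω i) Q)
    (hHT_int : ∀ t, t < m → ∀ i, Integrable (fun ω => HT t ω i) Q)
    -- generalized cost functions
    (c : ℕ → Ω → (Fin n → ℝ) → ℝ≥0∞)
    (hc0 : ∀ t ω, c t ω 0 = 0)
    (hc_conv : ∀ t ω (a b : Fin n → ℝ) (s : ℝ), 0 ≤ s → s ≤ 1 →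
      c t ω (s • a + (1 - s) • b)
        ≤ ENNReal.ofReal s * c t ω a + ENNReal.ofReal (1 - s) * c t ω b)
    (hc_lsc : ∀ t ω, LowerSemicontinuous (c t ω))
    (hc_meas : ∀ t, Measurable[(ℱ t).prod inferInstance]
      fun p : Ω × (Fin n → ℝ) => c t p.1 p.2)
    -- marginal costs `γ±` are the one-sided directional derivatives of `c` at `0`
    (γp γm : ℕ → Ω → Fin n → ℝ)
    (hγp_nonneg : ∀ t ω i, 0 ≤ γp t ω i) (hγm_nonneg : ∀ t ω i, 0 ≤ γm t ω i)
    (hγp_meas : ∀ t, Measurable[ℱ t] (γp t))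
    (hγm_meas : ∀ t, Measurable[ℱ t] (γm t))
    (hγp_deriv : ∀ t, t < m → ∀ ω i,
      Tendsto (fun ε : ℝ => c t ω (fun j => if j = i then ε else 0) / ENNReal.ofReal ε)
        (nhdsWithin 0 (Set.Ioi 0)) (nhds (ENNReal.ofReal (γp t ω i))))
    (hγm_deriv : ∀ t, t < m → ∀ ω i,
      Tendsto (fun ε : ℝ => c t ω (fun j => if j = i then -ε else 0) / ENNReal.ofReal ε)
        (nhdsWithin 0 (Set.Ioi 0)) (nhds (ENNReal.ofReal (γm t ω i))))
    -- the full cost dominates the marginal cost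
    (hcm : ∀ t, t < m → ∀ ω a, ENNReal.ofReal (mcost (γp t) (γm t) ω a) ≤ c t ω a) :
    -- (i) ↔ (iii)
    ((∀ a : ℕ → Ω → Fin n → ℝ, IsStrategy ℱ a → EssBdd Q a →
        ((∫ ω, gains m Hmid HT a ω ∂Q : ℝ) : EReal)
          ≤ ((∫⁻ ω, ∑ t ∈ Finset.range m, c t ω (a t ω) ∂Q : ℝ≥0∞) : EReal))
      ↔ (∀ t, t < m → ∀ i, ∀ᵐ ω ∂Q,
          -(γm t ω i) ≤ (Q[fun ω' => HT t ω' i - Hmid t ω' i|ℱ t]) ω ∧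
          (Q[fun ω' => HT t ω' i - Hmid t ω' i|ℱ t]) ω ≤ γp t ω i)) ∧
    -- (ii) ↔ (iii)
    ((∀ a : ℕ → Ω → Fin n → ℝ, IsStrategy ℱ a → EssBdd Q a →
        ((∫ ω, gains m Hmid HT a ω ∂Q : ℝ) : EReal)
          ≤ ((∫⁻ ω, ENNReal.ofReal
                (∑ t ∈ Finset.range m, mcost (γp t) (γm t) ω (a t ω)) ∂Q : ℝ≥0∞) : EReal))
      ↔ (∀ t, t < m → ∀ i, ∀ᵐ ω ∂Q,
          -(γm t ω i) ≤ (Q[fun ω' => HT t ω' i - Hmid t ω' i|ℱ t]) ω ∧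
          (Q[fun ω' => HT t ω' i - Hmid t ω' i|ℱ t]) ω ≤ γp t ω i)) ∧
    -- (iii) ↔ bid/ask spread formulation for the prices themselves
    ((∀ t, t < m → ∀ i, ∀ᵐ ω ∂Q,
        -(γm t ω i) ≤ (Q[fun ω' => HT t ω' i - Hmid t ω' i|ℱ t]) ω ∧
        (Q[fun ω' => HT t ω' i - Hmid t ω' i|ℱ t]) ω ≤ γp t ω i)
      ↔ (∀ t, t < m → ∀ i, ∀ᵐ ω ∂Q,
          Hmid t ω i - γm t ω i ≤ (Q[fun ω' => HT t ω' i|ℱ t]) ω ∧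
          (Q[fun ω' => HT t ω' i|ℱ t]) ω ≤ Hmid t ω i + γp t ω i)) := by
  have hDint : ∀ t, t < m → ∀ i, Integrable (fun ω => HT t ω i - Hmid t ω i) Q :=
    fun t ht i => (hHT_int t ht i).sub (hHmid_int t ht i)
  have hcmeas : ∀ t (v : Fin n → ℝ), Measurable[ℱ t] fun ω => c t ω v := fun t v =>
    (hc_meas t).comp (@measurable_prodMk_right _ _ (ℱ t) _ v)
  let ε : ℕ → ℝ := fun k => 1 / ((k : ℝ) + 1)
  have hε : ∀ k, 0 < ε k := fun k => Nat.one_div_pos_of_nat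
  have hεlim : Tendsto ε atTop (𝓝[>] 0) :=
    tendsto_nhdsWithin_iff.2 ⟨tendsto_one_div_add_atTop_nhds_zero_nat, Eventually.of_forall hε⟩
  have full_to_near : (∀ a : ℕ → Ω → Fin n → ℝ, IsStrategy ℱ a → EssBdd Q a →
        ((∫ ω, gains m Hmid HT a ω ∂Q : ℝ) : EReal)
          ≤ ((∫⁻ ω, ∑ t ∈ Finset.range m, c t ω (a t ω) ∂Q : ℝ≥0∞) : EReal)) →
      ∀ t, t < m → ∀ i, ∀ᵐ ω ∂Q,
          -(γm t ω i) ≤ (Q[fun ω' => HT t ω' i - Hmid t ω' i|ℱ t]) ω ∧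
          (Q[fun ω' => HT t ω' i - Hmid t ω' i|ℱ t]) ω ≤ γp t ω i := by
    intro h t ht i
    have hupper := condExp_le_of_tendsto_cost (hℱ t) (hDint t ht i) hε
      (fun k => hcmeas t fun j => if j = i then ε k else 0) (fun ω => hγp_nonneg t ω i)
      (fun ω => (hγp_deriv t ht ω i).comp hεlim)
      (fun k A hA => setIntegral_gain_le_setLIntegral_cost hℱ hc0 h ht i (ε k) hA)
    have hlower := condExp_le_of_tendsto_cost (hℱ t) (hDint t ht i).neg hε
      (fun k => hcmeas t fun j => if j = i then -ε k else 0) (fun ω => hγm_nonneg t ω i)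
      (fun ω => (hγm_deriv t ht ω i).comp hεlim)
      (fun k A hA => by
        simpa only [Pi.neg_apply, mul_neg, neg_mul] using
          setIntegral_gain_le_setLIntegral_cost hℱ hc0 h ht i (-ε k) hA)
    filter_upwards [hupper, hlower,
      condExp_neg (μ := Q) (fun ω => HT t ω i - Hmid t ω i) (ℱ t)] with ω h1 h2 h3
    rw [h3, Pi.neg_apply] at h2
    exact ⟨neg_le.1 h2, h1⟩
  have marginal_to_full : (∀ a : ℕ → Ω → Fin n → ℝ, IsStrategy ℱ a → EssBdd Q a →
        ((∫ ω, gains m Hmid HT a ω ∂Q : ℝ) : EReal)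
          ≤ ((∫⁻ ω, ENNReal.ofReal
                (∑ t ∈ Finset.range m, mcost (γp t) (γm t) ω (a t ω)) ∂Q : ℝ≥0∞) : EReal)) →
      ∀ a : ℕ → Ω → Fin n → ℝ, IsStrategy ℱ a → EssBdd Q a →
        ((∫ ω, gains m Hmid HT a ω ∂Q : ℝ) : EReal)
          ≤ ((∫⁻ ω, ∑ t ∈ Finset.range m, c t ω (a t ω) ∂Q : ℝ≥0∞) : EReal) := by
    intro h a ha hab
    refine (h a ha hab).trans (EReal.coe_ennreal_le_coe_ennreal_iff.2 (lintegral_mono fun ω => ?_))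
    rw [ENNReal.ofReal_sum_of_nonneg fun t _ =>
      mcost_nonneg (hγp_nonneg t ω) (hγm_nonneg t ω) (a t ω)]
    exact Finset.sum_le_sum fun t ht => hcm t (Finset.mem_range.1 ht) ω (a t ω)
  refine ⟨⟨full_to_near, fun h => marginal_to_full fun a =>
      integral_gains_le_lintegral_mcost hℱ hDint h⟩,
    ⟨fun h => full_to_near (marginal_to_full h), fun h a =>
      integral_gains_le_lintegral_mcost hℱ hDint h⟩,
    forall₃_congr fun t ht i => ?_⟩
  have hHmid : Measurable[ℱ t] fun ω => Hmid t ω i :=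
    (measurable_pi_apply i).comp (hHmid_meas t ht)
  have hsub := condExp_sub (hHT_int t ht i) (hHmid_int t ht i) (ℱ t)
  rw [condExp_of_stronglyMeasurable (hℱ t) hHmid.stronglyMeasurable (hHmid_int t ht i)] at hsub
  refine eventually_congr (hsub.mono fun ω hω => ?_)
  change (Q[fun ω' => HT t ω' i - Hmid t ω' i|ℱ t]) ω
    = (Q[fun ω' => HT t ω' i|ℱ t]) ω - Hmid t ω i at hω
  rw [hω]
  constructor <;> rintro ⟨h1, h2⟩ <;> constructor <;> linarith

end
end

section
/- Let (c_t) be generalized cost functions with marginal cost functions m_t(a) := a⁺ · γ_t⁺ + a⁻ · γ_t⁻ and total marginal cost M_T(a) := Σ_t m_t(a_t). Let y* ∈ ℝ and let a* be an essentially bounded strategy such that (y*, a*) maximizes F(y, a) := E[u(y + G(a) − M_T(a)) − y] over all y ∈ ℝ and all strategies a. Then D* := u'(y* + G(a*) − M_T(a*)) satisfies D* > 0 a.s. and E[D*] = 1, and the measure Q* with dQ* = D* dP is a near-martingale measure: for all t and i, −γ_tⁱ⁻ ≤ E_{Q*}[DH_tⁱ | 𝔉_t] ≤ γ_tⁱ⁺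 almost surely; in particular Q* is free of statistical arbitrage with marginal cost m. -/
open MeasureTheory Filter
open scoped ENNReal Topology

section

variable {Ω : Type*} [mΩ : MeasurableSpace Ω] {n : ℕ}

/-- The total marginal cost `M_T(a) = ∑_t m_t(a_t)`. -/
def totalMcost (m : ℕ) (γp γm : ℕ → Ω → Fin n → ℝ)
    (a : ℕ → Ω → Fin n → ℝ) (ω : Ω) : ℝ :=
  ∑ t ∈ Finset.range m, mcost (γp t) (γm t) ω (a t ω)

theorem max_add_mul_le_convexComb (x y ε : ℝ) (h0 : 0 ≤ ε) (h1 : ε ≤ 1) :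
    max (x + ε * y) 0 ≤ (1 - ε) * max x 0 + ε * max (x + y) 0 := by
  have hx := mul_le_mul_of_nonneg_left (le_max_left x 0) (sub_nonneg.2 h1)
  have hy := mul_le_mul_of_nonneg_left (le_max_left (x + y) 0) h0
  have hx0 := mul_nonneg (sub_nonneg.2 h1) (le_max_right x 0)
  have hy0 := mul_nonneg h0 (le_max_right (x + y) 0)
  exact max_le (by linarith) (by linarith)

theorem max_add_mul_le (x y ε : ℝ) (h0 : 0 ≤ ε) :
    max (x + ε * y) 0 ≤ max x 0 + ε * max y 0 := by
  have hx := le_max_left x 0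
  have hy := mul_le_mul_of_nonneg_left (le_max_left y 0) h0
  have hx0 := le_max_right x 0
  have hy0 := mul_nonneg h0 (le_max_right y 0)
  exact max_le (by linarith) (by linarith)

theorem totalMcost_nonneg {Ω : Type*} (m : ℕ) {γp γm : ℕ → Ω → Fin n → ℝ}
    (hγp : ∀ t ω i, 0 ≤ γp t ω i) (hγm : ∀ t ω i, 0 ≤ γm t ω i)
    (a : ℕ → Ω → Fin n → ℝ) (ω : Ω) : 0 ≤ totalMcost m γp γm a ω :=
  Finset.sum_nonneg fun t _ => Finset.sum_nonneg fun i _ => add_nonneg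
    (mul_nonneg (le_max_right _ _) (hγp t ω i)) (mul_nonneg (le_max_right _ _) (hγm t ω i))

theorem totalMcost_add_smul_le_convexComb {Ω : Type*} (m : ℕ) {γp γm : ℕ → Ω → Fin n → ℝ}
    (hγp : ∀ t ω i, 0 ≤ γp t ω i) (hγm : ∀ t ω i, 0 ≤ γm t ω i)
    (a b : ℕ → Ω → Fin n → ℝ) (ω : Ω) (ε : ℝ) (h0 : 0 ≤ ε) (h1 : ε ≤ 1) :
    totalMcost m γp γm (a + ε • b) ω
      ≤ (1 - ε) * totalMcost m γp γm a ω + ε * totalMcost m γp γm (a + b) ω := by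
  simp only [totalMcost, mcost, Finset.mul_sum, ← Finset.sum_add_distrib]
  refine Finset.sum_le_sum fun t _ => Finset.sum_le_sum fun i _ => ?_
  have hp := mul_le_mul_of_nonneg_right
    (max_add_mul_le_convexComb (a t ω i) (b t ω i) ε h0 h1) (hγp t ω i)
  have hm := mul_le_mul_of_nonneg_right
    (max_add_mul_le_convexComb (-a t ω i) (-b t ω i) ε h0 h1) (hγm t ω i)
  simp only [Pi.add_apply, Pi.smul_apply, smul_eq_mul, neg_add, ← mul_neg]
  linarith

theorem totalMcost_add_smul_le {Ω : Type*} (m : ℕ) {γp γm : ℕ → Ω → Fin n → ℝ}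
    (hγp : ∀ t ω i, 0 ≤ γp t ω i) (hγm : ∀ t ω i, 0 ≤ γm t ω i)
    (a b : ℕ → Ω → Fin n → ℝ) (ω : Ω) (ε : ℝ) (h0 : 0 ≤ ε) :
    totalMcost m γp γm (a + ε • b) ω
      ≤ totalMcost m γp γm a ω + ε * totalMcost m γp γm b ω := by
  simp only [totalMcost, mcost, Finset.mul_sum, ← Finset.sum_add_distrib]
  refine Finset.sum_le_sum fun t _ => Finset.sum_le_sum fun i _ => ?_
  have hp := mul_le_mul_of_nonneg_right
    (max_add_mul_le (a t ω i) (b t ω i) ε h0) (hγp t ω i)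
  have hm := mul_le_mul_of_nonneg_right
    (max_add_mul_le (-a t ω i) (-b t ω i) ε h0) (hγm t ω i)
  simp only [Pi.add_apply, Pi.smul_apply, smul_eq_mul, neg_add, ← mul_neg]
  linarith

theorem gains_add_smul {Ω : Type*} (m : ℕ) (Hmid HT : ℕ → Ω → Fin n → ℝ)
    (a b : ℕ → Ω → Fin n → ℝ) (ε : ℝ) (ω : Ω) :
    gains m Hmid HT (a + ε • b) ω = gains m Hmid HT a ω + ε * gains m Hmid HT b ω := by
  simp only [gains, Finset.mul_sum, ← Finset.sum_add_distrib]
  refine Finset.sum_congr rfl fun t _ => Finset.sum_congr rfl fun i _ => ?_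
  simp only [Pi.add_apply, Pi.smul_apply, smul_eq_mul]
  ring

theorem measurable_gains (m : ℕ) {Hmid HT a : ℕ → Ω → Fin n → ℝ}
    (hHmid : ∀ t, t < m → Measurable (Hmid t)) (hHT : ∀ t, t < m → Measurable (HT t))
    (ha : ∀ t, Measurable (a t)) : Measurable (gains m Hmid HT a) := by
  unfold gains
  refine Finset.measurable_fun_sum _ fun t ht => Finset.measurable_fun_sum _ fun i _ => ?_
  have h1 := measurable_pi_iff.1 (hHmid t (Finset.mem_range.1 ht)) i
  have h2 := measurable_pi_iff.1 (hHT t (Finset.mem_range.1 ht)) i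
  exact (measurable_pi_iff.1 (ha t) i).mul (h2.sub h1)

theorem measurable_totalMcost (m : ℕ) {γp γm a : ℕ → Ω → Fin n → ℝ}
    (hγp : ∀ t, Measurable (γp t)) (hγm : ∀ t, Measurable (γm t))
    (ha : ∀ t, Measurable (a t)) : Measurable (totalMcost m γp γm a) := by
  unfold totalMcost mcost
  refine Finset.measurable_fun_sum _ fun t _ => Finset.measurable_fun_sum _ fun i _ => ?_
  have h1 := measurable_pi_iff.1 (hγp t) i
  have h2 := measurable_pi_iff.1 (hγm t) i
  have h3 := measurable_pi_iff.1 (ha t) i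
  exact ((h3.max measurable_const).mul h1).add ((h3.neg.max measurable_const).mul h2)

/-- One-sided Fatou bound: if `f k` dominates both an integrable `g` and a sequence converging
to the integrable `L`, then a uniform bound on `∫ f k` bounds `∫ L`. -/
theorem integral_le_of_tendsto_of_integral_le {μ : Measure Ω} {f h : ℕ → Ω → ℝ} {g L : Ω → ℝ}
    {C : ℝ} (hf : ∀ k, Integrable (f k) μ) (hg : Integrable g μ) (hL : Integrable L μ)
    (hgf : ∀ k ω, g ω ≤ f k ω) (hhf : ∀ k ω, h k ω ≤ f k ω)
    (hlim : ∀ ω, Tendsto (fun k => h k ω) atTop (𝓝 (L ω))) (hC : ∀ k, ∫ ω, f k ω ∂μ ≤ C) :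
    ∫ ω, L ω ∂μ ≤ C := by
  have hgC : ∫ ω, g ω ∂μ ≤ C := (integral_mono hg (hf 0) (hgf 0)).trans (hC 0)
  have hpt : ∀ ω, ENNReal.ofReal (L ω - g ω)
      ≤ liminf (fun k => ENNReal.ofReal (f k ω - g ω)) atTop := by
    intro ω
    have ht : Tendsto (fun k => ENNReal.ofReal (h k ω - g ω)) atTop
        (𝓝 (ENNReal.ofReal (L ω - g ω))) :=
      ENNReal.tendsto_ofReal ((hlim ω).sub_const _)
    rw [← ht.liminf_eq]
    refine liminf_le_liminf (Eventually.of_forall fun k => ?_)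
    exact ENNReal.ofReal_le_ofReal (sub_le_sub_right (hhf k ω) _)
  have hbound : ∫⁻ ω, ENNReal.ofReal (L ω - g ω) ∂μ ≤ ENNReal.ofReal (C - ∫ ω, g ω ∂μ) := by
    refine (lintegral_mono hpt).trans ((lintegral_liminf_le' fun k =>
      ((hf k).sub hg).aestronglyMeasurable.aemeasurable.ennreal_ofReal).trans ?_)
    refine liminf_le_of_le (by isBoundedDefault) fun b hb => ?_
    obtain ⟨k, hk⟩ := hb.exists
    refine hk.trans ?_
    simp only [Pi.sub_apply]
    rw [← ofReal_integral_eq_lintegral_ofReal (f := fun ω => f k ω - g ω) ((hf k).sub hg)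
      (Eventually.of_forall fun ω => sub_nonneg.2 (hgf k ω)), integral_sub (hf k) hg]
    exact ENNReal.ofReal_le_ofReal (sub_le_sub_right (hC k) _)
  have h1 : ∫ ω, (L ω - g ω) ∂μ ≤ C - ∫ ω, g ω ∂μ := by
    rw [integral_eq_lintegral_pos_part_sub_lintegral_neg_part
      (f := fun ω => L ω - g ω) (hL.sub hg)]
    refine (sub_le_self _ ENNReal.toReal_nonneg).trans ?_
    exact ENNReal.toReal_le_of_le_ofReal (sub_nonneg.2 hgC) hbound
  rw [integral_sub hL hg] at h1
  linarith

/-- First-order optimality condition for expected concave utility along a pointwise concave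
curve of wealths `W` with supergradient-type lower bound `W 0 + ε Z ≤ W ε`. -/
theorem integral_deriv_mul_le_of_forall_integral_le {P : Measure Ω} {u : ℝ → ℝ}
    (hconc : ConcaveOn ℝ Set.univ u) (hmono : Monotone u) (hdiff : Differentiable ℝ u)
    {W : ℝ → Ω → ℝ} {Z : Ω → ℝ} {η : ℝ}
    (hWconc : ∀ ε ω, 0 ≤ ε → ε ≤ 1 → (1 - ε) * W 0 ω + ε * W 1 ω ≤ W ε ω)
    (hWZ : ∀ ε ω, 0 ≤ ε → W 0 ω + ε * Z ω ≤ W ε ω)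
    (hint : ∀ ε, Integrable (fun ω => u (W ε ω)) P)
    (hmax : ∀ ε, ∫ ω, u (W ε ω) ∂P - ε * η ≤ ∫ ω, u (W 0 ω) ∂P)
    (hZ : Integrable (fun ω => deriv u (W 0 ω) * Z ω) P) :
    ∫ ω, deriv u (W 0 ω) * Z ω ∂P ≤ η := by
  have hpos : ∀ k : ℕ, (0 : ℝ) < 1 / ((k : ℝ) + 1) := fun k => Nat.one_div_pos_of_nat
  have hle : ∀ k : ℕ, 1 / ((k : ℝ) + 1) ≤ 1 := fun k => by
    rw [div_le_one (by positivity)]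
    have : (0 : ℝ) ≤ k := Nat.cast_nonneg k
    linarith
  refine integral_le_of_tendsto_of_integral_le
    (f := fun k ω => (1 / ((k : ℝ) + 1))⁻¹ * (u (W (1 / ((k : ℝ) + 1)) ω) - u (W 0 ω)))
    (h := fun k ω => (1 / ((k : ℝ) + 1))⁻¹ *
      (u (W 0 ω + 1 / ((k : ℝ) + 1) * Z ω) - u (W 0 ω)))
    (g := fun ω => u (W 1 ω) - u (W 0 ω))
    (fun k => ((hint _).sub (hint 0)).const_mul _) ((hint 1).sub (hint 0)) hZ ?_ ?_ ?_ ?_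
  · intro k ω
    rw [inv_mul_eq_div, le_div_iff₀ (hpos k)]
    have h1 := hconc.2 (Set.mem_univ (W 0 ω)) (Set.mem_univ (W 1 ω))
      (sub_nonneg.2 (hle k)) (hpos k).le (by ring)
    have h2 := hmono (hWconc _ ω (hpos k).le (hle k))
    simp only [smul_eq_mul] at h1
    linarith
  · intro k ω
    exact mul_le_mul_of_nonneg_left
      (sub_le_sub_right (hmono (hWZ _ ω (hpos k).le)) _) (inv_nonneg.2 (hpos k).le)
  · intro ω
    have hd : HasDerivAt (fun s : ℝ => u (W 0 ω + s * Z ω)) (deriv u (W 0 ω) * Z ω) 0 := by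
      have hin : HasDerivAt (fun s : ℝ => W 0 ω + s * Z ω) (Z ω) 0 := by
        simpa using ((hasDerivAt_id (0 : ℝ)).mul_const (Z ω)).const_add (W 0 ω)
      refine HasDerivAt.comp (0 : ℝ) ?_ hin
      simpa using (hdiff (W 0 ω)).hasDerivAt
    have hs : Tendsto (fun k : ℕ => 1 / ((k : ℝ) + 1)) atTop (𝓝[≠] 0) :=
      tendsto_nhdsWithin_iff.2 ⟨tendsto_one_div_add_atTop_nhds_zero_nat,
        Eventually.of_forall fun k => (hpos k).ne'⟩
    have := (hasDerivAt_iff_tendsto_slope_zero.1 hd).comp hs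
    simpa [Function.comp_def] using this
  · intro k
    rw [integral_const_mul, integral_sub (hint _) (hint 0), inv_mul_eq_div,
      div_le_iff₀ (hpos k)]
    linarith [hmax (1 / ((k : ℝ) + 1))]

theorem ConcaveOn.deriv_pos_of_strictMono {u : ℝ → ℝ} (hconc : ConcaveOn ℝ Set.univ u)
    (hmono : StrictMono u) (hdiff : Differentiable ℝ u) (x : ℝ) : 0 < deriv u x := by
  have h := hconc.slope_le_deriv (Set.mem_univ x) (Set.mem_univ (x + 1))
    (by linarith) (hdiff x)
  refine lt_of_lt_of_le ?_ h
  simp only [slope_def_field]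
  exact div_pos (sub_pos.2 (hmono (by linarith))) (by linarith)

theorem ConcaveOn.deriv_le_sub {u : ℝ → ℝ} (hconc : ConcaveOn ℝ Set.univ u)
    (hdiff : Differentiable ℝ u) (x : ℝ) : deriv u x ≤ u x - u (x - 1) := by
  have h := hconc.deriv_le_slope (Set.mem_univ (x - 1)) (Set.mem_univ x)
    (by linarith) (hdiff x)
  simpa [slope_def_field] using h

/-- A conditional expectation is bounded by `g` as soon as the bound holds in mean on every
measurable set of the sub-σ-algebra on which `g` is bounded; `g` need not be integrable. -/
theorem condExp_le_of_forall_setIntegral_sub_nonpos {Q : Measure Ω} [IsFiniteMeasure Q]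
    {m₀ : MeasurableSpace Ω} (hm : m₀ ≤ mΩ) {f g : Ω → ℝ} (hf : Integrable f Q)
    (hg : Measurable[m₀] g)
    (h : ∀ A, MeasurableSet[m₀] A → (∃ N : ℝ, ∀ ω ∈ A, |g ω| ≤ N) →
      ∫ ω in A, (f ω - g ω) ∂Q ≤ 0) :
    ∀ᵐ ω ∂Q, (Q[f|m₀]) ω ≤ g ω := by
  have hE : Measurable[m₀] (Q[f|m₀]) := stronglyMeasurable_condExp.measurable
  have hnull : ∀ N : ℕ, Q ({ω | g ω < (Q[f|m₀]) ω} ∩ {ω | |g ω| ≤ N}) = 0 := by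
    intro N
    set A := {ω | g ω < (Q[f|m₀]) ω} ∩ {ω | |g ω| ≤ N} with hA
    have hAm : MeasurableSet[m₀] A :=
      MeasurableSet.inter (measurableSet_lt hg hE)
        (measurableSet_le (measurable_norm.comp hg) measurable_const)
    have hgi : IntegrableOn g A Q := by
      refine Measure.integrableOn_of_bounded (M := (N : ℝ)) (measure_ne_top Q A)
        (hg.mono hm le_rfl).aestronglyMeasurable ?_
      exact (ae_restrict_iff' (hm _ hAm)).2 (Eventually.of_forall fun ω hω => hω.2)
    have hle := h A hAm ⟨N, fun ω hω => hω.2⟩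
    rw [integral_sub hf.integrableOn hgi, ← setIntegral_condExp hm hf hAm,
      ← integral_sub integrable_condExp.integrableOn hgi] at hle
    have hnn : 0 ≤ᵐ[Q.restrict A] fun ω => (Q[f|m₀]) ω - g ω :=
      (ae_restrict_iff' (hm _ hAm)).2
        (Eventually.of_forall fun ω hω => sub_nonneg.2 (le_of_lt hω.1))
    have hz := (setIntegral_eq_zero_iff_of_nonneg_ae hnn
      (integrable_condExp.integrableOn.sub hgi)).1
      (le_antisymm hle (integral_nonneg_of_ae hnn))
    have hz' := (ae_restrict_iff' (hm _ hAm)).1 hz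
    refine measure_mono_null (fun ω hω => ?_) hz'
    intro hc
    exact absurd (hc hω) (sub_pos.2 hω.1).ne'
  have hU := measure_iUnion_null hnull
  refine measure_mono_null (fun ω hω => ?_) hU
  obtain ⟨N, hN⟩ := exists_nat_ge |g ω|
  exact Set.mem_iUnion.2 ⟨N, not_le.1 (show ¬(Q[f|m₀]) ω ≤ g ω from hω), hN⟩

open Classical in
/-- The strategy which holds `x` units of instrument `i` from time `t` on the event `A`. -/
noncomputable def singleTrade (t : ℕ) (i : Fin n) (A : Set Ω) (x : ℝ) : ℕ → Ω → Fin n → ℝ :=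
  fun s ω j => if s = t ∧ j = i ∧ ω ∈ A then x else 0

theorem isStrategy_singleTrade {Ω : Type*} {ℱ : ℕ → MeasurableSpace Ω} {t : ℕ} (i : Fin n) {A : Set Ω}
    (hA : MeasurableSet[ℱ t] A) (x : ℝ) : IsStrategy ℱ (singleTrade t i A x) := by
  intro s
  refine @measurable_pi_lambda _ _ _ (ℱ s) _ _ fun j => ?_
  by_cases hs : s = t ∧ j = i
  · obtain ⟨rfl, rfl⟩ := hs
    have : (fun ω : Ω => singleTrade s j A x s ω j) = A.indicator fun _ => x := by
      funext ω
      by_cases hω : ω ∈ A <;> simp [singleTrade, hω]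
    rw [this]
    exact measurable_const.indicator hA
  · have : (fun ω : Ω => singleTrade t i A x s ω j) = fun _ => 0 := by
      funext ω
      exact if_neg fun hc => hs ⟨hc.1, hc.2.1⟩
    rw [this]
    exact measurable_const

theorem sum_sum_singleTrade {Ω : Type*} {m t : ℕ} (ht : t < m) (i : Fin n) (A : Set Ω) (x : ℝ)
    (φ : ℕ → Fin n → ℝ → ℝ) (hφ : ∀ s j, φ s j 0 = 0) (ω : Ω) :
    ∑ s ∈ Finset.range m, ∑ j, φ s j (singleTrade t i A x s ω j)
      = A.indicator (fun _ => φ t i x) ω := by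
  rw [Finset.sum_eq_single_of_mem t (Finset.mem_range.2 ht),
    Finset.sum_eq_single_of_mem i (Finset.mem_univ i)]
  · by_cases hω : ω ∈ A <;> simp [singleTrade, hω, hφ]
  · intro j _ hj
    simp [singleTrade, hj, hφ]
  · intro s _ hs
    simp [singleTrade, hs, hφ]

theorem gains_singleTrade {Ω : Type*} {m t : ℕ} (ht : t < m) (Hmid HT : ℕ → Ω → Fin n → ℝ) (i : Fin n)
    (A : Set Ω) (x : ℝ) (ω : Ω) :
    gains m Hmid HT (singleTrade t i A x) ω
      = A.indicator (fun ω => x * (HT t ω i - Hmid t ω i)) ω :=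
  sum_sum_singleTrade ht i A x (fun s j x => x * (HT s ω j - Hmid s ω j)) (by simp) ω

theorem totalMcost_singleTrade {Ω : Type*} {m t : ℕ} (ht : t < m) (γp γm : ℕ → Ω → Fin n → ℝ) (i : Fin n)
    (A : Set Ω) (x : ℝ) (ω : Ω) :
    totalMcost m γp γm (singleTrade t i A x) ω
      = A.indicator (fun ω => max x 0 * γp t ω i + max (-x) 0 * γm t ω i) ω :=
  sum_sum_singleTrade ht i A x
    (fun s j x => max x 0 * γp s ω j + max (-x) 0 * γm s ω j) (by simp) ω

/-- Utility-based near-martingale measure under trading frictions: if `(y*, a*)`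
maximizes `F(y, a) = E[u(y + G(a) - M_T(a)) - y]`, then
`D* = u'(y* + G(a*) - M_T(a*))` is a strictly positive density with unit mass and
`Q*` with `dQ* = D* dP` is a near-martingale measure; in particular `Q*` is free of
statistical arbitrage with marginal cost `m`. -/
theorem utility_based_near_martingale_measure
    (P : Measure Ω) [IsProbabilityMeasure P] (m : ℕ)
    (ℱ : ℕ → MeasurableSpace Ω) (hℱ : ∀ t, ℱ t ≤ mΩ) (hℱmono : Monotone ℱ)
    (Hmid HT : ℕ → Ω → Fin n → ℝ)
    (hHmid_meas : ∀ t, t < m → Measurable[ℱ t] (Hmid t))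
    (hHT_meas : ∀ t, t < m → Measurable (HT t))
    (hHmid_int : ∀ t, t < m → ∀ i, Integrable (fun ω => Hmid t ω i) P)
    (hHT_int : ∀ t, t < m → ∀ i, Integrable (fun ω => HT t ω i) P)
    -- generalized cost functions with marginal costs `γ±`
    (c : ℕ → Ω → (Fin n → ℝ) → ℝ≥0∞)
    (hc0 : ∀ t ω, c t ω 0 = 0)
    (hc_conv : ∀ t ω (a b : Fin n → ℝ) (s : ℝ), 0 ≤ s → s ≤ 1 →
      c t ω (s • a + (1 - s) • b)
        ≤ ENNReal.ofReal s * c t ω a + ENNReal.ofReal (1 - s) * c t ω b)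
    (hc_lsc : ∀ t ω, LowerSemicontinuous (c t ω))
    (γp γm : ℕ → Ω → Fin n → ℝ)
    (hγp_nonneg : ∀ t ω i, 0 ≤ γp t ω i) (hγm_nonneg : ∀ t ω i, 0 ≤ γm t ω i)
    (hγp_meas : ∀ t, Measurable[ℱ t] (γp t))
    (hγm_meas : ∀ t, Measurable[ℱ t] (γm t))
    (hγp_deriv : ∀ t, t < m → ∀ ω i,
      Tendsto (fun ε : ℝ => c t ω (fun j => if j = i then ε else 0) / ENNReal.ofReal ε)
        (nhdsWithin 0 (Set.Ioi 0)) (nhds (ENNReal.ofReal (γp t ω i))))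
    (hγm_deriv : ∀ t, t < m → ∀ ω i,
      Tendsto (fun ε : ℝ => c t ω (fun j => if j = i then -ε else 0) / ENNReal.ofReal ε)
        (nhdsWithin 0 (Set.Ioi 0)) (nhds (ENNReal.ofReal (γm t ω i))))
    -- the utility
    (u : ℝ → ℝ)
    (hu_conc : StrictConcaveOn ℝ Set.univ u) (hu_mono : StrictMono u)
    (hu_C1 : ContDiff ℝ 1 u) (hu0 : u 0 = 0) (hu'0 : deriv u 0 = 1)
    (hu_int : ∀ (y : ℝ) (a : ℕ → Ω → Fin n → ℝ), IsStrategy ℱ a →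
      Integrable
        (fun ω => u (y + gains m Hmid HT a ω - totalMcost m γp γm a ω)) P)
    -- the maximizer of `F(y, a) = E[u(y + G(a) - M_T(a)) - y]`
    (ystar : ℝ) (astar : ℕ → Ω → Fin n → ℝ)
    (hastar : IsStrategy ℱ astar) (hastar_bdd : EssBdd P astar)
    (hmax : ∀ (y : ℝ) (a : ℕ → Ω → Fin n → ℝ), IsStrategy ℱ a →
      (∫ ω, u (y + gains m Hmid HT a ω - totalMcost m γp γm a ω) ∂P) - y
        ≤ (∫ ω, u (ystar + gains m Hmid HT astar ω
              - totalMcost m γp γm astar ω) ∂P) - ystar)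
    (D : Ω → ℝ)
    (hD : ∀ ω, D ω = deriv u (ystar + gains m Hmid HT astar ω
        - totalMcost m γp γm astar ω))
    (Q : Measure Ω) (hQ : Q = P.withDensity (fun ω => ENNReal.ofReal (D ω))) :
    -- positivity and unit expectation of the density
    (∀ᵐ ω ∂P, 0 < D ω) ∧
    Integrable D P ∧ (∫ ω, D ω ∂P) = 1 ∧
    -- `Q*` is a near-martingale measure
    (∀ t, t < m → ∀ i, ∀ᵐ ω ∂Q,
      -(γm t ω i) ≤ (Q[fun ω' => HT t ω' i - Hmid t ω' i|ℱ t]) ω ∧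
      (Q[fun ω' => HT t ω' i - Hmid t ω' i|ℱ t]) ω ≤ γp t ω i) ∧
    -- in particular, `Q*` is free of statistical arbitrage with marginal cost `m`
    (∀ a : ℕ → Ω → Fin n → ℝ, IsStrategy ℱ a → EssBdd Q a →
      ((∫ ω, gains m Hmid HT a ω ∂Q : ℝ) : EReal)
        ≤ ((∫⁻ ω, ENNReal.ofReal (totalMcost m γp γm a ω) ∂Q : ℝ≥0∞) : EReal)) := by
  have hdiff : Differentiable ℝ u := hu_C1.differentiable one_ne_zero
  have hconc := hu_conc.concaveOn
  have hDpos : ∀ ω, 0 < D ω := fun ω => by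
    rw [hD]
    exact hconc.deriv_pos_of_strictMono hu_mono hdiff _
  have hGm : ∀ a, IsStrategy ℱ a → Measurable (gains m Hmid HT a) := fun a ha =>
    measurable_gains m (fun t ht => (hHmid_meas t ht).mono (hℱ t) le_rfl) hHT_meas
      fun t => (ha t).mono (hℱ t) le_rfl
  have hMm : ∀ a, IsStrategy ℱ a → Measurable (totalMcost m γp γm a) := fun a ha =>
    measurable_totalMcost m (fun t => (hγp_meas t).mono (hℱ t) le_rfl)
      (fun t => (hγm_meas t).mono (hℱ t) le_rfl) fun t => (ha t).mono (hℱ t) le_rfl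
  have hDm : Measurable D := by
    rw [funext hD]
    exact (hu_C1.continuous_deriv le_rfl).measurable.comp
      (((hGm _ hastar).const_add _).sub (hMm _ hastar))
  have hDint : Integrable D P := by
    refine ((hu_int ystar astar hastar).sub (hu_int (ystar - 1) astar hastar)).mono'
      hDm.aestronglyMeasurable (Eventually.of_forall fun ω => ?_)
    rw [Real.norm_of_nonneg (hDpos ω).le, hD]
    refine (hconc.deriv_le_sub hdiff _).trans_eq ?_
    simp only [Pi.sub_apply]
    congr 2
    ring
  have hopt : ∀ (η : ℝ) (b : ℕ → Ω → Fin n → ℝ), IsStrategy ℱ b →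
      Integrable (fun ω => D ω * (η + gains m Hmid HT b ω - totalMcost m γp γm b ω)) P →
      ∫ ω, D ω * (η + gains m Hmid HT b ω - totalMcost m γp γm b ω) ∂P ≤ η := by
    intro η b hb hbint
    have hstr : ∀ ε : ℝ, IsStrategy ℱ (astar + ε • b) := fun ε t =>
      (hastar t).add ((hb t).const_smul ε)
    have h0 : ∀ ω, ystar + 0 * η + gains m Hmid HT (astar + (0 : ℝ) • b) ω
        - totalMcost m γp γm (astar + (0 : ℝ) • b) ω
        = ystar + gains m Hmid HT astar ω - totalMcost m γp γm astar ω := by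
      intro ω
      simp
    have key := integral_deriv_mul_le_of_forall_integral_le (P := P) hconc hu_mono.monotone hdiff
      (W := fun ε ω => ystar + ε * η + gains m Hmid HT (astar + ε • b) ω
        - totalMcost m γp γm (astar + ε • b) ω)
      (Z := fun ω => η + gains m Hmid HT b ω - totalMcost m γp γm b ω) (η := η)
    simp only [h0, ← hD] at key
    refine key ?_ ?_ (fun ε => hu_int _ _ (hstr ε)) ?_ hbint
    · intro ε ω hε0 hε1
      have := totalMcost_add_smul_le_convexComb m hγp_nonneg hγm_nonneg astar b ω ε hε0 hε1
      have hG1 := gains_add_smul m Hmid HT astar b 1 ω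
      simp only [gains_add_smul, one_smul, one_mul] at this hG1 ⊢
      rw [hG1]
      linarith
    · intro ε ω hε0
      have := totalMcost_add_smul_le m hγp_nonneg hγm_nonneg astar b ω ε hε0
      rw [gains_add_smul]
      linarith
    · intro ε
      linarith [hmax (ystar + ε * η) _ (hstr ε)]
  have hzero : IsStrategy ℱ (0 : ℕ → Ω → Fin n → ℝ) := fun t => measurable_const
  have hG0 : ∀ ω, gains m Hmid HT 0 ω = 0 := fun ω => by simp [gains]
  have hM0 : ∀ ω, totalMcost m γp γm 0 ω = 0 := fun ω => by simp [totalMcost, mcost]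
  have hDone : ∫ ω, D ω ∂P = 1 := by
    refine le_antisymm ?_ ?_
    · have := hopt 1 0 hzero
      simp only [hG0, hM0, add_zero, sub_zero, mul_one] at this
      exact this hDint
    · have := hopt (-1) 0 hzero
      simp only [hG0, hM0, add_zero, sub_zero, mul_neg, mul_one] at this
      have := this hDint.neg
      rw [integral_neg] at this
      linarith
  have hQint : ∀ f : Ω → ℝ, Integrable f Q ↔ Integrable (fun ω => D ω * f ω) P := by
    intro f
    rw [hQ, integrable_withDensity_iff hDm.ennreal_ofReal
      (Eventually.of_forall fun ω => ENNReal.ofReal_lt_top)]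
    simp only [ENNReal.toReal_ofReal (hDpos _).le, mul_comm]
  have hQeq : ∀ f : Ω → ℝ, ∫ ω, f ω ∂Q = ∫ ω, D ω * f ω ∂P := by
    intro f
    rw [hQ, integral_withDensity_eq_integral_toReal_smul hDm.ennreal_ofReal
      (Eventually.of_forall fun ω => ENNReal.ofReal_lt_top)]
    simp only [ENNReal.toReal_ofReal (hDpos _).le, smul_eq_mul]
  have hQfin : IsFiniteMeasure Q := by
    rw [hQ]
    exact isFiniteMeasure_withDensity_ofReal hDint.2
  have hoptQ : ∀ b : ℕ → Ω → Fin n → ℝ, IsStrategy ℱ b →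
      Integrable (fun ω => gains m Hmid HT b ω - totalMcost m γp γm b ω) Q →
      ∫ ω, (gains m Hmid HT b ω - totalMcost m γp γm b ω) ∂Q ≤ 0 := by
    intro b hb hbint
    have := hopt 0 b hb
    simp only [zero_add] at this
    rw [hQeq]
    exact this ((hQint _).1 hbint)
  -- a single trade of size `x` in instrument `i` on an event where its marginal cost is bounded
  have hsingle : ∀ t, t < m → ∀ i (x : ℝ) (g : Ω → ℝ), Measurable[ℱ t] g →
      (∀ ω, max x 0 * γp t ω i + max (-x) 0 * γm t ω i = g ω) →
      Integrable (fun ω => x * (HT t ω i - Hmid t ω i)) Q →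
      ∀ A, MeasurableSet[ℱ t] A → (∃ N : ℝ, ∀ ω ∈ A, |g ω| ≤ N) →
        ∫ ω in A, (x * (HT t ω i - Hmid t ω i) - g ω) ∂Q ≤ 0 := by
    rintro t ht i x g hg hcost hint A hA ⟨N, hN⟩
    have hAm := hℱ t _ hA
    have hgi : IntegrableOn g A Q :=
      Measure.integrableOn_of_bounded (M := N) (measure_ne_top Q A)
        (hg.mono (hℱ t) le_rfl).aestronglyMeasurable
        ((ae_restrict_iff' hAm).2 (Eventually.of_forall hN))
    have heq : (fun ω => gains m Hmid HT (singleTrade t i A x) ω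
        - totalMcost m γp γm (singleTrade t i A x) ω)
        = A.indicator fun ω => x * (HT t ω i - Hmid t ω i) - g ω := by
      funext ω
      rw [gains_singleTrade ht, totalMcost_singleTrade ht]
      by_cases hω : ω ∈ A <;> simp [hω, hcost]
    have := hoptQ _ (isStrategy_singleTrade i hA x)
    rw [heq, integral_indicator hAm, integrable_indicator_iff hAm] at this
    exact this (hint.integrableOn.sub hgi)
  refine ⟨Eventually.of_forall hDpos, hDint, hDone, ?_, ?_⟩
  · intro t ht i
    by_cases hint : Integrable (fun ω => HT t ω i - Hmid t ω i) Q
    · have hγpm : Measurable[ℱ t] fun ω => γp t ω i := (measurable_pi_apply i).comp (hγp_meas t)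
      have hγmm : Measurable[ℱ t] fun ω => γm t ω i := (measurable_pi_apply i).comp (hγm_meas t)
      have hbuy := hsingle t ht i 1 _ hγpm (by simp) (hint.const_mul _)
      have hsell := hsingle t ht i (-1) _ hγmm (by simp) (hint.const_mul _)
      simp only [one_mul] at hbuy
      simp only [neg_one_mul] at hsell
      have hup := condExp_le_of_forall_setIntegral_sub_nonpos (hℱ t) hint hγpm hbuy
      have hlo := condExp_le_of_forall_setIntegral_sub_nonpos (hℱ t) hint.neg hγmm hsell
      filter_upwards [hup, hlo, condExp_neg (μ := Q) (fun ω => HT t ω i - Hmid t ω i) (ℱ t)]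
        with ω h1 h2 h3
      rw [h3, Pi.neg_apply] at h2
      exact ⟨by linarith, h1⟩
    · rw [condExp_of_not_integrable hint]
      exact Eventually.of_forall fun ω => ⟨neg_nonpos.2 (hγm_nonneg t ω i), hγp_nonneg t ω i⟩
  · intro a ha _
    by_cases hG : Integrable (gains m Hmid HT a) Q
    · by_cases hM : ∫⁻ ω, ENNReal.ofReal (totalMcost m γp γm a ω) ∂Q = ⊤
      · simp [hM]
      · have hMnn := totalMcost_nonneg m hγp_nonneg hγm_nonneg a
        have hMi : Integrable (totalMcost m γp γm a) Q :=
          (lintegral_ofReal_ne_top_iff_integrable (hMm a ha).aestronglyMeasurable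
            (Eventually.of_forall hMnn)).1 hM
        have := hoptQ a ha (hG.sub hMi)
        rw [integral_sub hG hMi] at this
        rw [← ofReal_integral_eq_lintegral_ofReal hMi (Eventually.of_forall hMnn),
          EReal.coe_ennreal_ofReal, max_eq_left (integral_nonneg hMnn)]
        exact_mod_cast sub_nonpos.1 this
    · rw [integral_undef hG]
      exact EReal.coe_ennreal_nonneg _

end
end

section
/- Under the assumptions of the near-martingale construction — (y*, a*) an essentially bounded maximizer of F(y, a) := E[u(y + G(a) − M_T(a)) − y], D* := u'(y* + G(a*) − M_T(a*)), dQ* = D* dP — the optimal strategy a* satisfies the following first-order characterization for every t and every coordinate i: on the event {a*_tⁱ > 0}, E_{Q*}[DH_tⁱ | 𝔉_t] = γ_tⁱ⁺ almost surely; on {a*_tⁱ < 0}, E_{Q*}[DH_tⁱ | 𝔉_t] = −γ_tⁱ⁻ almost surely; and on {a*_tⁱ = 0}, −γ_tⁱ⁻ ≤ E_{Q*}[DH_tⁱ | 𝔉_t] ≤ γ_tⁱ⁺ almost surely. -/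
open MeasureTheory Filter
open scoped ENNReal Topology

section

variable {Ω : Type*} [mΩ : MeasurableSpace Ω] {n : ℕ}

/-- The marginal cost of a position `x` in a single instrument with marginal ask cost `γp` and
marginal bid cost `γm`. -/
def posCost (γp γm x : ℝ) : ℝ :=
  max x 0 * γp + max (-x) 0 * γm

theorem posCost_sub_of_nonneg (γp γm : ℝ) {x y : ℝ} (hx : 0 ≤ x) (hy : 0 ≤ y) :
    posCost γp γm y - posCost γp γm x = (y - x) * γp := by
  rw [posCost, posCost, max_eq_left hx, max_eq_left hy, max_eq_right (neg_nonpos.2 hx),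
    max_eq_right (neg_nonpos.2 hy)]
  ring

theorem posCost_sub_of_nonpos (γp γm : ℝ) {x y : ℝ} (hx : x ≤ 0) (hy : y ≤ 0) :
    posCost γp γm y - posCost γp γm x = (y - x) * -γm := by
  rw [posCost, posCost, max_eq_right hx, max_eq_right hy, max_eq_left (neg_nonneg.2 hx),
    max_eq_left (neg_nonneg.2 hy)]
  ring

/-- `posCost γp γm` is Lipschitz with constant `γp + γm`. -/
theorem abs_posCost_sub_le {γp γm : ℝ} (hp : 0 ≤ γp) (hm : 0 ≤ γm) (x y : ℝ) :
    |posCost γp γm y - posCost γp γm x| ≤ |y - x| * (γp + γm) := by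
  have h : posCost γp γm y - posCost γp γm x
      = (max y 0 - max x 0) * γp + (max (-y) 0 - max (-x) 0) * γm := by
    unfold posCost; ring
  have h₁ : |max y 0 - max x 0| ≤ |y - x| := abs_max_sub_max_le_abs y x 0
  have h₂ : |max (-y) 0 - max (-x) 0| ≤ |y - x| := by
    refine (abs_max_sub_max_le_abs (-y) (-x) 0).trans_eq ?_
    rw [← abs_neg]; congr 1; ring
  rw [h, mul_add]
  refine (abs_add_le _ _).trans ?_
  rw [abs_mul, abs_mul, abs_of_nonneg hp, abs_of_nonneg hm]
  gcongr

/-- Moving symmetrically from `x` to a long and to a short position costs a full spread. -/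
theorem posCost_symm_add (γp γm x : ℝ) :
    posCost γp γm (x + (|x| + 1)) + posCost γp γm (x - (|x| + 1))
      = 2 * posCost γp γm x + (γp + γm) := by
  unfold posCost
  rcases le_total 0 x with h | h
  · rw [abs_of_nonneg h, max_eq_left (by linarith), max_eq_right (by linarith),
      max_eq_right (by linarith), max_eq_left (by linarith), max_eq_left h,
      max_eq_right (by linarith)]
    ring
  · rw [abs_of_nonpos h, max_eq_left (by linarith), max_eq_right (by linarith),
      max_eq_right (by linarith), max_eq_left (by linarith), max_eq_right h,
      max_eq_left (by linarith)]
    ring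

/-- Replacing the position in instrument `i` at time `t` changes the net terminal gains by the
gains of the position change minus the change of its marginal cost. -/
theorem net_gains_update {α : Type*} {m d : ℕ} (Hmid HT γp γm a : ℕ → α → Fin d → ℝ)
    {t : ℕ} (ht : t < m) (i : Fin d) (b : α → ℝ) (ω : α) :
    gains m Hmid HT (Function.update a t fun ω => Function.update (a t ω) i (b ω)) ω
        - totalMcost m γp γm (Function.update a t fun ω => Function.update (a t ω) i (b ω)) ω
      = gains m Hmid HT a ω - totalMcost m γp γm a ω
        + ((b ω - a t ω i) * (HT t ω i - Hmid t ω i)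
          - (posCost (γp t ω i) (γm t ω i) (b ω) - posCost (γp t ω i) (γm t ω i) (a t ω i))) := by
  set a' : ℕ → α → Fin d → ℝ :=
    Function.update a t fun ω => Function.update (a t ω) i (b ω) with ha'
  have key : ∀ f : ℕ → Fin d → ℝ → ℝ,
      ∑ s ∈ Finset.range m, ∑ j, f s j (a' s ω j) - ∑ s ∈ Finset.range m, ∑ j, f s j (a s ω j)
        = f t i (b ω) - f t i (a t ω i) := by
    intro f
    simp only [← Finset.sum_sub_distrib]
    rw [Finset.sum_eq_single_of_mem t (Finset.mem_range.2 ht),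
      Finset.sum_eq_single_of_mem i (Finset.mem_univ i)]
    · simp [ha']
    · intro j _ hj
      simp [ha', hj]
    · intro s _ hs
      simp [ha', hs]
  have h₁ := key fun s j x => x * (HT s ω j - Hmid s ω j)
  have h₂ := key fun s j x => posCost (γp s ω j) (γm s ω j) x
  unfold gains totalMcost mcost
  unfold posCost at h₂ ⊢
  linarith

theorem IsStrategy.update {α : Type*} {d : ℕ} {ℱ : ℕ → MeasurableSpace α}
    {a : ℕ → α → Fin d → ℝ} (ha : IsStrategy ℱ a) (t : ℕ) (i : Fin d)
    {b : α → ℝ} (hb : Measurable[ℱ t] b) :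
    IsStrategy ℱ (Function.update a t fun ω => Function.update (a t ω) i (b ω)) := by
  intro s
  rcases eq_or_ne s t with rfl | hs
  · rw [Function.update_self]
    refine @measurable_pi_lambda _ _ _ (ℱ s) _ _ fun j => ?_
    rcases eq_or_ne j i with rfl | hj
    · simpa using hb
    · simpa [hj, Function.comp_def] using (measurable_pi_apply j).comp (ha s)
  · rw [Function.update_of_ne hs]
    exact ha s

/-- A concave function lies below its tangents. -/
theorem ConcaveOn.le_add_deriv_mul {u : ℝ → ℝ} (hu : ConcaveOn ℝ Set.univ u)
    (hd : Differentiable ℝ u) (x z : ℝ) : u (x + z) ≤ u x + deriv u x * z := by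
  rcases lt_trichotomy z 0 with hz | rfl | hz
  · have h := hu.deriv_le_slope (Set.mem_univ (x + z)) (Set.mem_univ x) (by linarith) (hd x)
    rw [slope_def_field, le_div_iff₀ (by linarith)] at h
    linarith
  · simp
  · have h := hu.slope_le_deriv (Set.mem_univ x) (Set.mem_univ (x + z)) (by linarith) (hd x)
    rw [slope_def_field, div_le_iff₀ (by linarith)] at h
    linarith

/-- The difference quotients of a concave function in a fixed direction decrease in the step. -/
theorem ConcaveOn.mul_sub_le_sub {u : ℝ → ℝ} (hu : ConcaveOn ℝ Set.univ u) (x z : ℝ)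
    {ε : ℝ} (h0 : 0 ≤ ε) (h1 : ε ≤ 1) : ε * (u (x + z) - u x) ≤ u (x + ε * z) - u x := by
  have h := hu.2 (Set.mem_univ x) (Set.mem_univ (x + z)) (sub_nonneg.2 h1) h0 (by ring)
  simp only [smul_eq_mul] at h
  rw [show (1 - ε) * x + ε * (x + z) = x + ε * z by ring] at h
  linarith

/-- First-order condition: if expected concave utility does not increase along the segment from
`X` to `X + Z`, the expected directional derivative at `X` is nonpositive. -/
theorem integral_deriv_mul_nonpos {P : Measure Ω} {u : ℝ → ℝ} (hu : ConcaveOn ℝ Set.univ u)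
    (hu_C1 : ContDiff ℝ 1 u) {X Z : Ω → ℝ}
    (h_int : ∀ ε : ℝ, 0 ≤ ε → ε ≤ 1 → Integrable (fun ω => u (X ω + ε * Z ω)) P)
    (hDZ : Integrable (fun ω => deriv u (X ω) * Z ω) P)
    (hle : ∀ ε : ℝ, 0 ≤ ε → ε ≤ 1 → ∫ ω, u (X ω + ε * Z ω) ∂P ≤ ∫ ω, u (X ω) ∂P) :
    ∫ ω, deriv u (X ω) * Z ω ∂P ≤ 0 := by
  have hd : Differentiable ℝ u := hu_C1.differentiable one_ne_zero
  have hX_int : Integrable (fun ω => u (X ω)) P := by simpa using h_int 0 le_rfl zero_le_one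
  have hXZ_int : Integrable (fun ω => u (X ω + Z ω)) P := by
    simpa using h_int 1 zero_le_one le_rfl
  set ε : ℕ → ℝ := fun k => 1 / ((k : ℝ) + 1) with hε
  have hε0 : ∀ k, 0 < ε k := fun k => Nat.one_div_pos_of_nat
  have hε1 : ∀ k, ε k ≤ 1 := fun k => by
    rw [hε]; exact (div_le_one (by positivity)).2 (by linarith [k.cast_nonneg (α := ℝ)])
  have hlim : Tendsto (fun k => ∫ ω, (ε k)⁻¹ * (u (X ω + ε k * Z ω) - u (X ω)) ∂P) atTop
      (𝓝 (∫ ω, deriv u (X ω) * Z ω ∂P)) := by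
    refine tendsto_integral_of_dominated_convergence
      (fun ω => |u (X ω + Z ω) - u (X ω)| + |deriv u (X ω) * Z ω|) (fun k => ?_)
      ((hXZ_int.sub hX_int).abs.add hDZ.abs) (fun k => ?_) ?_
    · exact (((h_int _ (hε0 k).le (hε1 k)).sub hX_int).const_mul _).aestronglyMeasurable
    · refine Eventually.of_forall fun ω => ?_
      have h₁ := hu.mul_sub_le_sub (X ω) (Z ω) (hε0 k).le (hε1 k)
      have h₂ := hu.le_add_deriv_mul hd (X ω) (ε k * Z ω)
      have h₃ : u (X ω + Z ω) - u (X ω) ≤ (ε k)⁻¹ * (u (X ω + ε k * Z ω) - u (X ω)) := by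
        rwa [le_inv_mul_iff₀ (hε0 k)]
      have h₄ : (ε k)⁻¹ * (u (X ω + ε k * Z ω) - u (X ω)) ≤ deriv u (X ω) * Z ω := by
        rw [inv_mul_le_iff₀ (hε0 k)]; linarith
      rw [Real.norm_eq_abs, abs_le]
      constructor
      · linarith [neg_abs_le (u (X ω + Z ω) - u (X ω)), abs_nonneg (deriv u (X ω) * Z ω)]
      · linarith [le_abs_self (deriv u (X ω) * Z ω), abs_nonneg (u (X ω + Z ω) - u (X ω))]
    · refine Eventually.of_forall fun ω => ?_
      have hder : HasDerivAt (fun r : ℝ => u (X ω + r * Z ω)) (deriv u (X ω) * Z ω) 0 := by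
        have h₁ : HasDerivAt (fun r : ℝ => X ω + r * Z ω) (Z ω) 0 := by
          simpa using ((hasDerivAt_id (0 : ℝ)).mul_const (Z ω)).const_add (X ω)
        have h₂ : HasDerivAt u (deriv u (X ω)) (X ω + 0 * Z ω) := by
          simpa using (hd (X ω)).hasDerivAt
        exact h₂.comp (0 : ℝ) h₁
      have hε_tendsto : Tendsto ε atTop (𝓝[≠] 0) :=
        tendsto_nhdsWithin_iff.2 ⟨tendsto_one_div_add_atTop_nhds_zero_nat,
          Eventually.of_forall fun k => (hε0 k).ne'⟩
      simpa [Function.comp_def] using hder.tendsto_slope_zero.comp hε_tendsto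
  refine le_of_tendsto' hlim fun k => ?_
  rw [integral_const_mul, integral_sub (h_int _ (hε0 k).le (hε1 k)) hX_int]
  exact mul_nonpos_of_nonneg_of_nonpos (inv_pos.2 (hε0 k)).le
    (sub_nonpos.2 (hle _ (hε0 k).le (hε1 k)))

theorem clamp_mul_self_nonneg {l r d : ℝ} (hl : l ≤ 0) (hr : 0 ≤ r) :
    0 ≤ max l (min r d) * d := by
  rcases le_total 0 d with h | h
  · exact mul_nonneg ((le_min hr h).trans (le_max_right _ _)) h
  · exact mul_nonneg_of_nonpos_of_nonpos (max_le hl ((min_le_right _ _).trans h)) h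

theorem nonpos_of_clamp_mul_self_eq_zero {l r d : ℝ} (hr : 0 < r)
    (h : max l (min r d) * d = 0) : d ≤ 0 := by
  by_contra! hd
  exact (mul_pos ((lt_min hr hd).trans_le (le_max_right _ _)) hd).ne' h

theorem nonneg_of_clamp_mul_self_eq_zero {l r d : ℝ} (hl : l < 0)
    (h : max l (min r d) * d = 0) : 0 ≤ d := by
  by_contra! hd
  exact (mul_pos_of_neg_of_neg (max_lt hl ((min_le_right _ _).trans_lt hd)) hd).ne' h

/-- If `w` has the sign of `Q[Y|𝓖] - s` but the expectation of `w * (Y - s)` is nonpositive, then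
`w` vanishes wherever `Q[Y|𝓖] ≠ s`. -/
theorem ae_mul_condExp_sub_eq_zero {α : Type*} {𝓖 mα : MeasurableSpace α} (h𝓖 : 𝓖 ≤ mα)
    {Q : Measure α}
    [IsFiniteMeasure Q] {Y s w : α → ℝ} (hY : Integrable Y Q) (hs : Integrable s Q)
    (hs_meas : Measurable[𝓖] s) (hw_meas : Measurable[𝓖] w) (hw : ∀ ω, |w ω| ≤ 1)
    (hle : ∫ ω, w ω * (Y ω - s ω) ∂Q ≤ 0) (hsign : ∀ ω, 0 ≤ w ω * ((Q[Y|𝓖]) ω - s ω)) :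
    ∀ᵐ ω ∂Q, w ω * ((Q[Y|𝓖]) ω - s ω) = 0 := by
  have h₁ : Q[w * (Y - s)|𝓖] =ᵐ[Q] w * Q[Y - s|𝓖] :=
    condExp_stronglyMeasurable_mul_of_bound h𝓖 hw_meas.stronglyMeasurable (hY.sub hs) 1
      (Eventually.of_forall hw)
  have h₂ : Q[Y - s|𝓖] =ᵐ[Q] Q[Y|𝓖] - s := by
    have h := condExp_sub hY hs 𝓖
    rwa [condExp_of_stronglyMeasurable h𝓖 hs_meas.stronglyMeasurable hs] at h
  have h₃ : Q[w * (Y - s)|𝓖] =ᵐ[Q] fun ω => w ω * ((Q[Y|𝓖]) ω - s ω) := by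
    filter_upwards [h₁, h₂] with ω h₁ h₂
    rw [h₁, Pi.mul_apply, h₂, Pi.sub_apply]
  have h_int : ∫ ω, w ω * ((Q[Y|𝓖]) ω - s ω) ∂Q = ∫ ω, w ω * (Y ω - s ω) ∂Q := by
    rw [← integral_congr_ae h₃, integral_condExp h𝓖]
    rfl
  exact (integral_eq_zero_iff_of_nonneg hsign (integrable_condExp.congr h₃)).1
    (le_antisymm (h_int.trans_le hle) (integral_nonneg hsign))

/-- The first-order conditions for a single instrument with return `Y`, given that the position
`a` is optimal among all `𝓖`-measurable positions when the remaining wealth is kept fixed. -/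
theorem condExp_return_of_optimal_position {α : Type*} {𝓖 mα : MeasurableSpace α}
    (h𝓖 : 𝓖 ≤ mα) {P : Measure α} {u : ℝ → ℝ} (hu : ConcaveOn ℝ Set.univ u)
    (hu_C1 : ContDiff ℝ 1 u) (hu_mono : Monotone u)
    {X Y a γp γm : α → ℝ}
    (hX : Measurable X) (hY : Measurable Y) (ha : Measurable[𝓖] a)
    (hγp : Measurable[𝓖] γp) (hγm : Measurable[𝓖] γm)
    (hγp0 : ∀ ω, 0 ≤ γp ω) (hγm0 : ∀ ω, 0 ≤ γm ω)
    (hshift : ∀ y : ℝ, Integrable (fun ω => u (X ω + y)) P)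
    (h_int : ∀ b : α → ℝ, Measurable[𝓖] b → Integrable (fun ω => u (X ω + ((b ω - a ω) * Y ω
      - (posCost (γp ω) (γm ω) (b ω) - posCost (γp ω) (γm ω) (a ω))))) P)
    (hmax : ∀ b : α → ℝ, Measurable[𝓖] b → ∫ ω, u (X ω + ((b ω - a ω) * Y ω
      - (posCost (γp ω) (γm ω) (b ω) - posCost (γp ω) (γm ω) (a ω)))) ∂P ≤ ∫ ω, u (X ω) ∂P)
    {Q : Measure α} (hQ : Q = P.withDensity fun ω => ENNReal.ofReal (deriv u (X ω))) :
    ∀ᵐ ω ∂Q, (0 < a ω → (Q[Y|𝓖]) ω = γp ω) ∧ (a ω < 0 → (Q[Y|𝓖]) ω = -(γm ω)) ∧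
      (a ω = 0 → -(γm ω) ≤ (Q[Y|𝓖]) ω ∧ (Q[Y|𝓖]) ω ≤ γp ω) := by
  have hd : Differentiable ℝ u := hu_C1.differentiable one_ne_zero
  have hD_meas : Measurable fun ω => deriv u (X ω) :=
    (hu_C1.continuous_deriv le_rfl).measurable.comp hX
  have hD0 : ∀ ω, 0 ≤ deriv u (X ω) := fun ω => hu_mono.deriv_nonneg
  have hX_int : Integrable (fun ω => u (X ω)) P := by simpa using hshift 0
  have ha' := ha.mono h𝓖 le_rfl
  have hγp' := hγp.mono h𝓖 le_rfl
  have hγm' := hγm.mono h𝓖 le_rfl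
  -- Integrability against the density.
  have hsandwich : ∀ {f g h : α → ℝ}, Measurable g → Integrable f P → Integrable h P →
      (∀ ω, f ω ≤ g ω) → (∀ ω, g ω ≤ h ω) → Integrable g P := by
    intro f g h hg hf hh hfg hgh
    refine (hf.abs.add hh.abs).mono' hg.aestronglyMeasurable (Eventually.of_forall fun ω => ?_)
    rw [Real.norm_eq_abs, Pi.add_apply, abs_le]
    constructor
    · linarith [hfg ω, neg_abs_le (f ω), abs_nonneg (h ω)]
    · linarith [hgh ω, le_abs_self (h ω), abs_nonneg (f ω)]
  have hD_int : Integrable (fun ω => deriv u (X ω)) P := by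
    refine hsandwich hD_meas ((hshift 1).sub hX_int) (hX_int.sub (hshift (-1)))
      (fun ω => ?_) (fun ω => ?_)
    · have := hu.le_add_deriv_mul hd (X ω) 1
      simp only [Pi.sub_apply]; linarith
    · have := hu.le_add_deriv_mul hd (X ω) (-1)
      simp only [Pi.sub_apply]; linarith
  have hDγ_int : Integrable (fun ω => deriv u (X ω) * (γp ω + γm ω)) P := by
    have habs : Measurable[𝓖] fun ω => |a ω| + 1 := (continuous_abs.measurable.comp ha).add_const 1
    have hb := h_int _ (ha.add habs)
    have hc := h_int _ (ha.sub habs)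
    refine hsandwich (hD_meas.mul (hγp'.add hγm')) (integrable_zero α ℝ P)
      ((hX_int.sub hb).add (hX_int.sub hc))
      (fun ω => mul_nonneg (hD0 ω) (add_nonneg (hγp0 ω) (hγm0 ω))) (fun ω => ?_)
    have h₁ := hu.le_add_deriv_mul hd (X ω) ((a ω + (|a ω| + 1) - a ω) * Y ω
      - (posCost (γp ω) (γm ω) (a ω + (|a ω| + 1)) - posCost (γp ω) (γm ω) (a ω)))
    have h₂ := hu.le_add_deriv_mul hd (X ω) ((a ω - (|a ω| + 1) - a ω) * Y ω
      - (posCost (γp ω) (γm ω) (a ω - (|a ω| + 1)) - posCost (γp ω) (γm ω) (a ω)))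
    have h₃ : deriv u (X ω) * ((a ω + (|a ω| + 1) - a ω) * Y ω
          - (posCost (γp ω) (γm ω) (a ω + (|a ω| + 1)) - posCost (γp ω) (γm ω) (a ω)))
        + deriv u (X ω) * ((a ω - (|a ω| + 1) - a ω) * Y ω
          - (posCost (γp ω) (γm ω) (a ω - (|a ω| + 1)) - posCost (γp ω) (γm ω) (a ω)))
        = -(deriv u (X ω) * (γp ω + γm ω)) := by
      linear_combination -(deriv u (X ω)) * posCost_symm_add (γp ω) (γm ω) (a ω)
    simp only [Pi.add_apply, Pi.sub_apply]
    linarith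
  have hDγp_int : Integrable (fun ω => deriv u (X ω) * γp ω) P :=
    hsandwich (hD_meas.mul hγp') (integrable_zero α ℝ P) hDγ_int
      (fun ω => mul_nonneg (hD0 ω) (hγp0 ω))
      (fun ω => mul_le_mul_of_nonneg_left (by linarith [hγm0 ω]) (hD0 ω))
  have hDγm_int : Integrable (fun ω => deriv u (X ω) * γm ω) P :=
    hsandwich (hD_meas.mul hγm') (integrable_zero α ℝ P) hDγ_int
      (fun ω => mul_nonneg (hD0 ω) (hγm0 ω))
      (fun ω => mul_le_mul_of_nonneg_left (by linarith [hγp0 ω]) (hD0 ω))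
  have hDY_int : Integrable (fun ω => deriv u (X ω) * Y ω) P := by
    have hb := h_int _ (ha.add_const 1)
    have hc := h_int _ (ha.sub_const 1)
    refine hsandwich (hD_meas.mul hY) ((hb.sub hX_int).sub hDγ_int)
      ((hX_int.sub hc).add hDγ_int) (fun ω => ?_) (fun ω => ?_)
    · have h₁ := hu.le_add_deriv_mul hd (X ω) ((a ω + 1 - a ω) * Y ω
        - (posCost (γp ω) (γm ω) (a ω + 1) - posCost (γp ω) (γm ω) (a ω)))
      have h₂ := (abs_le.1 (abs_posCost_sub_le (hγp0 ω) (hγm0 ω) (a ω) (a ω + 1))).1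
      rw [add_sub_cancel_left, abs_one, one_mul] at h₂
      have h₃ := mul_le_mul_of_nonneg_left h₂ (hD0 ω)
      simp only [Pi.sub_apply]
      linarith
    · have h₁ := hu.le_add_deriv_mul hd (X ω) ((a ω - 1 - a ω) * Y ω
        - (posCost (γp ω) (γm ω) (a ω - 1) - posCost (γp ω) (γm ω) (a ω)))
      have h₂ := (abs_le.1 (abs_posCost_sub_le (hγp0 ω) (hγm0 ω) (a ω) (a ω - 1))).1
      rw [sub_sub_cancel_left, abs_neg, abs_one, one_mul] at h₂
      have h₃ := mul_le_mul_of_nonneg_left h₂ (hD0 ω)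
      simp only [Pi.sub_apply, Pi.add_apply]
      linarith
  -- Passage between `P` and `Q`.
  have hlt : ∀ᵐ ω ∂P, ENNReal.ofReal (deriv u (X ω)) < ∞ :=
    Eventually.of_forall fun ω => ENNReal.ofReal_lt_top
  have hQ_int : ∀ {f : α → ℝ}, Integrable (fun ω => deriv u (X ω) * f ω) P → Integrable f Q := by
    intro f hf
    rw [hQ, integrable_withDensity_iff_integrable_smul' hD_meas.ennreal_ofReal hlt]
    simpa only [ENNReal.toReal_ofReal (hD0 _), smul_eq_mul] using hf
  have hQ_integral : ∀ f : α → ℝ, ∫ ω, f ω ∂Q = ∫ ω, deriv u (X ω) * f ω ∂P := by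
    intro f
    rw [hQ, integral_withDensity_eq_integral_toReal_smul hD_meas.ennreal_ofReal hlt]
    simp only [ENNReal.toReal_ofReal (hD0 _), smul_eq_mul]
  have : IsFiniteMeasure Q := hQ ▸ isFiniteMeasure_withDensity_ofReal hD_int.2
  have hYQ := hQ_int hDY_int
  have hγpQ := hQ_int hDγp_int
  have hγmQ := hQ_int hDγm_int
  -- Optimality along a direction `w` in which the cost is linear with slope `s`.
  have hdir : ∀ w s : α → ℝ, Measurable[𝓖] w → Measurable[𝓖] s → Integrable s Q →
      (∀ ω, |w ω| ≤ 1) → (∀ ω (ε : ℝ), 0 ≤ ε → ε ≤ 1 →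
        posCost (γp ω) (γm ω) (a ω + ε * w ω) - posCost (γp ω) (γm ω) (a ω)
          = (a ω + ε * w ω - a ω) * s ω) →
      (∀ ω, 0 ≤ w ω * ((Q[Y|𝓖]) ω - s ω)) → ∀ᵐ ω ∂Q, w ω * ((Q[Y|𝓖]) ω - s ω) = 0 := by
    intro w s hw hs hsQ hw1 hlin hsign
    refine ae_mul_condExp_sub_eq_zero h𝓖 hYQ hsQ hs hw hw1 ?_ hsign
    have heq : ∀ ε : ℝ, 0 ≤ ε → ε ≤ 1 → ∀ ω, X ω + ε * (w ω * (Y ω - s ω))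
        = X ω + ((a ω + ε * w ω - a ω) * Y ω - (posCost (γp ω) (γm ω) (a ω + ε * w ω)
          - posCost (γp ω) (γm ω) (a ω))) := by
      intro ε h0 h1 ω
      rw [hlin ω ε h0 h1]; ring
    have hw' := hw.mono h𝓖 le_rfl
    rw [hQ_integral]
    refine integral_deriv_mul_nonpos hu hu_C1 ?_ ?_ ?_
    · intro ε h0 h1
      simp only [heq ε h0 h1]
      exact h_int _ (ha.add (hw.const_mul ε))
    · have hwQ : Integrable (fun ω => w ω * (Y ω - s ω)) Q :=
        (hYQ.sub hsQ).bdd_mul hw'.aestronglyMeasurable (Eventually.of_forall hw1)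
      rw [hQ, integrable_withDensity_iff_integrable_smul' hD_meas.ennreal_ofReal hlt] at hwQ
      simpa only [ENNReal.toReal_ofReal (hD0 _), smul_eq_mul] using hwQ
    · intro ε h0 h1
      simp only [heq ε h0 h1]
      exact hmax _ (ha.add (hw.const_mul ε))
  have hce : Measurable[𝓖] (Q[Y|𝓖]) := stronglyMeasurable_condExp.measurable
  have hlong := hdir
    (fun ω => if 0 ≤ a ω then max (max (-1) (-a ω)) (min 1 ((Q[Y|𝓖]) ω - γp ω)) else 0) γp
    (Measurable.ite (ha measurableSet_Ici)
      ((measurable_const.max ha.neg).max (measurable_const.min (hce.sub hγp))) measurable_const)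
    hγp hγpQ
    (fun ω => by
      split_ifs with h
      · exact abs_le.2 ⟨(le_max_left _ _).trans (le_max_left _ _),
          max_le (max_le (by norm_num) (by linarith)) (min_le_left _ _)⟩
      · simp)
    (fun ω ε h0 h1 => by
      split_ifs with h
      · refine posCost_sub_of_nonneg _ _ h ?_
        have h₁ : -a ω ≤ max (max (-1) (-a ω)) (min 1 ((Q[Y|𝓖]) ω - γp ω)) :=
          (le_max_right _ _).trans (le_max_left _ _)
        nlinarith
      · simp)
    (fun ω => by
      split_ifs with h
      · exact clamp_mul_self_nonneg (max_le (by norm_num) (by linarith)) zero_le_one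
      · simp)
  have hshort := hdir
    (fun ω => if a ω ≤ 0 then max (-1) (min (min 1 (-a ω)) ((Q[Y|𝓖]) ω - -γm ω)) else 0)
    (fun ω => -γm ω)
    (Measurable.ite (ha measurableSet_Iic)
      (measurable_const.max ((measurable_const.min ha.neg).min (hce.sub hγm.neg)))
      measurable_const)
    hγm.neg hγmQ.neg
    (fun ω => by
      split_ifs with h
      · exact abs_le.2 ⟨le_max_left _ _,
          max_le (by norm_num) ((min_le_left _ _).trans (min_le_left _ _))⟩
      · simp)
    (fun ω ε h0 h1 => by
      split_ifs with h
      · refine posCost_sub_of_nonpos _ _ h ?_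
        have h₁ : max (-1) (min (min 1 (-a ω)) ((Q[Y|𝓖]) ω - -γm ω)) ≤ -a ω :=
          max_le (by linarith) ((min_le_left _ _).trans (min_le_right _ _))
        nlinarith
      · simp)
    (fun ω => by
      split_ifs with h
      · exact clamp_mul_self_nonneg (by norm_num) (le_min zero_le_one (by linarith))
      · simp)
  filter_upwards [hlong, hshort] with ω hl hs
  refine ⟨fun h => ?_, fun h => ?_, fun h => ⟨?_, ?_⟩⟩
  · rw [if_pos h.le] at hl
    have h₁ := nonpos_of_clamp_mul_self_eq_zero one_pos hl
    have h₂ := nonneg_of_clamp_mul_self_eq_zero (max_lt (by norm_num) (by linarith)) hl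
    linarith
  · rw [if_pos h.le] at hs
    have h₁ := nonpos_of_clamp_mul_self_eq_zero (lt_min one_pos (by linarith)) hs
    have h₂ := nonneg_of_clamp_mul_self_eq_zero (by norm_num) hs
    linarith
  · rw [if_pos h.le] at hs
    have h₂ := nonneg_of_clamp_mul_self_eq_zero (by norm_num) hs
    linarith
  · rw [if_pos h.ge] at hl
    have h₁ := nonpos_of_clamp_mul_self_eq_zero one_pos hl
    linarith

/-- First-order characterization of the optimal strategy under the near-martingale
measure `Q*`: on `{a*_tⁱ > 0}` the conditional expected return equals the marginal
ask cost `γ_tⁱ⁺`, on `{a*_tⁱ < 0}` it equals `-γ_tⁱ⁻`, and on `{a*_tⁱ = 0}` it lies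
within the marginal bid/ask spread. -/
theorem first_order_characterization_of_optimal_strategy
    (P : Measure Ω) [IsProbabilityMeasure P] (m : ℕ)
    (ℱ : ℕ → MeasurableSpace Ω) (hℱ : ∀ t, ℱ t ≤ mΩ) (hℱmono : Monotone ℱ)
    (Hmid HT : ℕ → Ω → Fin n → ℝ)
    (hHmid_meas : ∀ t, t < m → Measurable[ℱ t] (Hmid t))
    (hHT_meas : ∀ t, t < m → Measurable (HT t))
    (hHmid_int : ∀ t, t < m → ∀ i, Integrable (fun ω => Hmid t ω i) P)
    (hHT_int : ∀ t, t < m → ∀ i, Integrable (fun ω => HT t ω i) P)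
    -- generalized cost functions with marginal costs `γ±`
    (c : ℕ → Ω → (Fin n → ℝ) → ℝ≥0∞)
    (hc0 : ∀ t ω, c t ω 0 = 0)
    (hc_conv : ∀ t ω (a b : Fin n → ℝ) (s : ℝ), 0 ≤ s → s ≤ 1 →
      c t ω (s • a + (1 - s) • b)
        ≤ ENNReal.ofReal s * c t ω a + ENNReal.ofReal (1 - s) * c t ω b)
    (hc_lsc : ∀ t ω, LowerSemicontinuous (c t ω))
    (γp γm : ℕ → Ω → Fin n → ℝ)
    (hγp_nonneg : ∀ t ω i, 0 ≤ γp t ω i) (hγm_nonneg : ∀ t ω i, 0 ≤ γm t ω i)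
    (hγp_meas : ∀ t, Measurable[ℱ t] (γp t))
    (hγm_meas : ∀ t, Measurable[ℱ t] (γm t))
    (hγp_deriv : ∀ t, t < m → ∀ ω i,
      Tendsto (fun ε : ℝ => c t ω (fun j => if j = i then ε else 0) / ENNReal.ofReal ε)
        (nhdsWithin 0 (Set.Ioi 0)) (nhds (ENNReal.ofReal (γp t ω i))))
    (hγm_deriv : ∀ t, t < m → ∀ ω i,
      Tendsto (fun ε : ℝ => c t ω (fun j => if j = i then -ε else 0) / ENNReal.ofReal ε)
        (nhdsWithin 0 (Set.Ioi 0)) (nhds (ENNReal.ofReal (γm t ω i))))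
    -- the utility
    (u : ℝ → ℝ)
    (hu_conc : StrictConcaveOn ℝ Set.univ u) (hu_mono : StrictMono u)
    (hu_C1 : ContDiff ℝ 1 u) (hu0 : u 0 = 0) (hu'0 : deriv u 0 = 1)
    (hu_int : ∀ (y : ℝ) (a : ℕ → Ω → Fin n → ℝ), IsStrategy ℱ a →
      Integrable
        (fun ω => u (y + gains m Hmid HT a ω - totalMcost m γp γm a ω)) P)
    -- the maximizer of `F(y, a) = E[u(y + G(a) - M_T(a)) - y]`
    (ystar : ℝ) (astar : ℕ → Ω → Fin n → ℝ)
    (hastar : IsStrategy ℱ astar) (hastar_bdd : EssBdd P astar)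
    (hmax : ∀ (y : ℝ) (a : ℕ → Ω → Fin n → ℝ), IsStrategy ℱ a →
      (∫ ω, u (y + gains m Hmid HT a ω - totalMcost m γp γm a ω) ∂P) - y
        ≤ (∫ ω, u (ystar + gains m Hmid HT astar ω
              - totalMcost m γp γm astar ω) ∂P) - ystar)
    (D : Ω → ℝ)
    (hD : ∀ ω, D ω = deriv u (ystar + gains m Hmid HT astar ω
        - totalMcost m γp γm astar ω))
    (Q : Measure Ω) (hQ : Q = P.withDensity (fun ω => ENNReal.ofReal (D ω))) :
    ∀ t, t < m → ∀ i, ∀ᵐ ω ∂Q,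
      (0 < astar t ω i →
        (Q[fun ω' => HT t ω' i - Hmid t ω' i|ℱ t]) ω = γp t ω i) ∧
      (astar t ω i < 0 →
        (Q[fun ω' => HT t ω' i - Hmid t ω' i|ℱ t]) ω = -(γm t ω i)) ∧
      (astar t ω i = 0 →
        -(γm t ω i) ≤ (Q[fun ω' => HT t ω' i - Hmid t ω' i|ℱ t]) ω ∧
        (Q[fun ω' => HT t ω' i - Hmid t ω' i|ℱ t]) ω ≤ γp t ω i) := by
  have hγp_coord : ∀ t i, Measurable[ℱ t] fun ω => γp t ω i :=
    fun t i => (measurable_pi_apply i).comp (hγp_meas t)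
  have hγm_coord : ∀ t i, Measurable[ℱ t] fun ω => γm t ω i :=
    fun t i => (measurable_pi_apply i).comp (hγm_meas t)
  have ha_coord : ∀ t i, Measurable[ℱ t] fun ω => astar t ω i :=
    fun t i => (measurable_pi_apply i).comp (hastar t)
  have hDH : ∀ t, t < m → ∀ i, Measurable fun ω => HT t ω i - Hmid t ω i := fun t ht i =>
    (measurable_pi_iff.1 (hHT_meas t ht) i).sub
      (measurable_pi_iff.1 ((hHmid_meas t ht).mono (hℱ t) le_rfl) i)
  have hX : Measurable fun ω =>
      ystar + gains m Hmid HT astar ω - totalMcost m γp γm astar ω := by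
    have ha' := fun t i => (ha_coord t i).mono (hℱ t) le_rfl
    have hγp' := fun t i => (hγp_coord t i).mono (hℱ t) le_rfl
    have hγm' := fun t i => (hγm_coord t i).mono (hℱ t) le_rfl
    unfold gains totalMcost mcost
    refine (measurable_const.add ?_).sub ?_
    · exact Finset.measurable_fun_sum _ fun t ht => Finset.measurable_fun_sum _ fun i _ =>
        (ha' t i).mul (hDH t (Finset.mem_range.1 ht) i)
    · exact Finset.measurable_fun_sum _ fun t _ => Finset.measurable_fun_sum _ fun i _ =>
        (((ha' t i).max measurable_const).mul (hγp' t i)).add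
          (((ha' t i).neg.max measurable_const).mul (hγm' t i))
  intro t ht i
  have hnet : ∀ (b : Ω → ℝ) (ω : Ω),
      ystar + gains m Hmid HT astar ω - totalMcost m γp γm astar ω
        + ((b ω - astar t ω i) * (HT t ω i - Hmid t ω i)
          - (posCost (γp t ω i) (γm t ω i) (b ω)
            - posCost (γp t ω i) (γm t ω i) (astar t ω i)))
      = ystar
        + gains m Hmid HT
          (Function.update astar t fun ω => Function.update (astar t ω) i (b ω)) ω
        - totalMcost m γp γm
          (Function.update astar t fun ω => Function.update (astar t ω) i (b ω)) ω := by
    intro b ω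
    linarith [net_gains_update Hmid HT γp γm astar ht i b ω]
  refine condExp_return_of_optimal_position (P := P) (hℱ t) hu_conc.concaveOn hu_C1
    hu_mono.monotone hX
    (hDH t ht i) (ha_coord t i) (hγp_coord t i) (hγm_coord t i) (fun ω => hγp_nonneg t ω i)
    (fun ω => hγm_nonneg t ω i) (fun y => ?_) (fun b hb => ?_) (fun b hb => ?_) ?_
  · refine (hu_int (ystar + y) astar hastar).congr (Eventually.of_forall fun ω => ?_)
    exact congrArg u (by ring)
  · simp only [hnet]
    exact hu_int ystar _ (hastar.update t i hb)
  · simp only [hnet]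
    linarith [hmax ystar _ (hastar.update t i hb)]
  · simp only [hQ, hD]

end
end
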